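/- In A(𝓗^+) the following hold for all indices a,b,c,d in {1,…,ℓ}: (i) E^u_{ab} * E^u_{cd} = δ_{bc} E^u_{ad}; (ii) E^t_{ab} * E^t_{cd} = δ_{bc} E^t_{ad}; (iii) E^u_{ab} * E^t_{cd} = 0 and E^t_{cd} * E^u_{ab} = 0; (iv) for a ≠ b, Λ_{ab} * E^u_{cd} = E^u_{cd} * Λ_{ab} = 0 and Λ_{ab} * E^t_{cd} = E^t_{cd} * Λ_{ab} = 0; (v) for a,b,c distinct, Λ_{ab} * Λ_{bc} = 2ω_b * Λ_{ac}. -/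

import Mathlib

/-!
Common framework: vertex operator algebras over ℂ encoded via their modes,
weak/admissible/ordinary modules, twisted modules, Zhu's algebra data,
and the free bosonic (Heisenberg) vertex operator algebra `𝓗 = M(1)` of rank `ℓ`
together with its `θ`-fixed subalgebra `𝓗⁺`.
-/

open scoped BigOperators DirectSum TensorProduct

noncomputable section

/-- Generalized binomial coefficient `(q choose n)` for `q : ℚ`. -/
def qchoose (q : ℚ) : ℕ → ℚ
  | 0 => 1
  | n + 1 => qchoose q n * (q - n) / (n + 1)

/-- Generalized binomial coefficient of an integer, as a complex number. -/
def zchoose (m : ℤ) (n : ℕ) : ℂ := ((qchoose (m : ℚ) n : ℚ) : ℂ)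

/-- A vertex operator algebra over `ℂ`, encoded through its modes:
`Y u n : Module.End ℂ V` is the `n`-th mode `u_n` of the vertex operator `Y(u,z)`.
The axioms are: truncation, the vacuum and creation axioms, the (component form of
the) Jacobi/Borcherds identity, a lower-truncated `ℤ`-grading by `L(0)`-eigenvalues
with finite dimensional homogeneous pieces compatible with the modes, the Virasoro
relations for the conformal vector and the `L(-1)`-derivative (translation) axiom. -/
structure VOA (V : Type) [AddCommGroup V] [Module ℂ V] : Type where
  Y : V →ₗ[ℂ] ℤ → Module.End ℂ V
  one : V
  omega : V
  wt : ℤ → Submodule ℂ V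
  centralCharge : ℂ
  internal : DirectSum.IsInternal wt
  one_wt : one ∈ wt 0
  omega_wt : omega ∈ wt 2
  one_ne_zero : one ≠ 0
  fdim : ∀ n : ℤ, FiniteDimensional ℂ (wt n)
  bounded_below : ∃ N : ℤ, ∀ n : ℤ, n < N → wt n = ⊥
  trunc : ∀ u v : V, ∃ N : ℤ, ∀ n : ℤ, N ≤ n → Y u n v = 0
  vacuum_act : ∀ n : ℤ, Y one n = if n = -1 then (1 : Module.End ℂ V) else 0
  create : ∀ u : V, Y u (-1) one = u
  create_ge : ∀ (u : V) (n : ℤ), 0 ≤ n → Y u n one = 0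
  mode_wt : ∀ (k : ℤ) (u : V), u ∈ wt k → ∀ (m n : ℤ) (v : V), v ∈ wt m →
    Y u n v ∈ wt (m + k - n - 1)
  L0_diag : ∀ (n : ℤ) (v : V), v ∈ wt n → Y omega 1 v = (n : ℂ) • v
  translation : ∀ (u : V) (n : ℤ), Y (Y omega 0 u) n = (-(n : ℂ)) • Y u (n - 1)
  virasoro : ∀ m n : ℤ,
    Y omega (m + 1) * Y omega (n + 1) - Y omega (n + 1) * Y omega (m + 1)
      = ((m : ℂ) - (n : ℂ)) • Y omega (m + n + 1)
        + (if m + n = 0 then (((m ^ 3 - m : ℤ) : ℂ) / 12) * centralCharge else 0)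
            • (1 : Module.End ℂ V)
  borcherds : ∀ (u v w : V) (p m n : ℤ),
    ∑ᶠ i : ℕ, zchoose m i • Y (Y u (p + i) v) (m + n - i) w
      = ∑ᶠ i : ℕ, ((-1 : ℂ) ^ i * zchoose p i) •
          (Y u (m + p - i) (Y v (n + i) w)
            - ((-1 : ℂ) ^ p) • Y v (n + p - i) (Y u (m + i) w))

variable {V : Type} [AddCommGroup V] [Module ℂ V]

/-- Simplicity of a vertex operator algebra: the only subspaces invariant under
all modes are `0` and the whole space. -/
def VOA.Simple (A : VOA V) : Prop :=
  ∀ U : Submodule ℂ V, (∀ (u : V) (n : ℤ) (v : V), v ∈ U → A.Y u n v ∈ U) → U = ⊥ ∨ U = ⊤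

/-- The decomposition of a vertex operator algebra into its homogeneous pieces. -/
noncomputable def VOA.decompose (A : VOA V) : V ≃ₗ[ℂ] ⨁ n : ℤ, A.wt n :=
  (LinearEquiv.ofBijective (DirectSum.coeLinearMap A.wt) A.internal).symm

/-- The homogeneous component of weight `n` of a vector. -/
noncomputable def VOA.hcomp (A : VOA V) (n : ℤ) (u : V) : V := (A.decompose u n : V)

/-- Zhu's product `u * v` for `u` (treated as) homogeneous of weight `k`:
`u*v = ∑_{i≥0} (k choose i) u_{i-1} v`. -/
noncomputable def VOA.mulAux (A : VOA V) (k : ℤ) (u v : V) : V :=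
  ∑ᶠ i : ℕ, zchoose k i • A.Y u ((i : ℤ) - 1) v

/-- Zhu's circle product `u ∘ v` for `u` (treated as) homogeneous of weight `k`:
`u∘v = ∑_{i≥0} (k choose i) u_{i-2} v`. -/
noncomputable def VOA.circAux (A : VOA V) (k : ℤ) (u v : V) : V :=
  ∑ᶠ i : ℕ, zchoose k i • A.Y u ((i : ℤ) - 2) v

/-- Zhu's product `u * v`, extended bilinearly via homogeneous components of `u`. -/
noncomputable def VOA.star (A : VOA V) (u v : V) : V :=
  ∑ᶠ k : ℤ, A.mulAux k (A.hcomp k u) v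

/-- The subspace `O(V)` spanned by all circle products `u ∘ v` with `u` homogeneous;
Zhu's algebra is `A(V) = V/O(V)` with product induced by `VOA.star`. -/
def VOA.Osub (A : VOA V) : Submodule ℂ V :=
  Submodule.span ℂ {w | ∃ (k : ℤ) (u v : V), u ∈ A.wt k ∧ w = A.circAux k u v}

/-- A weak module for a vertex operator algebra, given by modes satisfying
truncation, the vacuum axiom and the Borcherds identity. -/
structure WkMod (A : VOA V) (M : Type) [AddCommGroup M] [Module ℂ M] : Type where
  act : V →ₗ[ℂ] ℤ → Module.End ℂ M
  trunc : ∀ (u : V) (w : M), ∃ N : ℤ, ∀ n : ℤ, N ≤ n → act u n w = 0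
  vacuum_act : ∀ n : ℤ, act A.one n = if n = -1 then (1 : Module.End ℂ M) else 0
  borcherds : ∀ (u v : V) (w : M) (p m n : ℤ),
    ∑ᶠ i : ℕ, zchoose m i • act (A.Y u (p + i) v) (m + n - i) w
      = ∑ᶠ i : ℕ, ((-1 : ℂ) ^ i * zchoose p i) •
          (act u (m + p - i) (act v (n + i) w)
            - ((-1 : ℂ) ^ p) • act v (n + p - i) (act u (m + i) w))

/-- An admissible (`ℕ`-gradable) module for a vertex operator algebra:
a weak module with an `ℕ`-grading with nonzero top level, compatible with weights. -/
structure AdmMod (A : VOA V) (M : Type) [AddCommGroup M] [Module ℂ M]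
    extends WkMod A M : Type where
  gr : ℕ → Submodule ℂ M
  grInternal : DirectSum.IsInternal gr
  top_ne_bot : gr 0 ≠ ⊥
  gr_mode : ∀ (k : ℤ) (u : V), u ∈ A.wt k → ∀ (m : ℤ) (n : ℕ) (w : M), w ∈ gr n →
    act u m w ∈
      if 0 ≤ (n : ℤ) + k - m - 1 then gr ((n : ℤ) + k - m - 1).toNat else ⊥

/-- An ordinary module for a vertex operator algebra: a weak module on which `L(0)`
acts semisimply with finite dimensional eigenspaces whose weights are truncated from
below in each coset `λ + ℤ`. -/
structure OrdMod (A : VOA V) (M : Type) [AddCommGroup M] [Module ℂ M]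
    extends WkMod A M : Type where
  wtm : ℂ → Submodule ℂ M
  indep : iSupIndep wtm
  spans : ⨆ c : ℂ, wtm c = ⊤
  L0_diag : ∀ (c : ℂ) (w : M), w ∈ wtm c → act A.omega 1 w = c • w
  fdim : ∀ c : ℂ, FiniteDimensional ℂ (wtm c)
  bounded_below : ∀ c : ℂ, ∃ N : ℤ, ∀ m : ℤ, m < N → wtm (c + m) = ⊥

/-- Irreducibility of a weak module. -/
def WkMod.Irreducible {A : VOA V} {M : Type} [AddCommGroup M] [Module ℂ M]
    (P : WkMod A M) : Prop :=
  (∃ w : M, w ≠ 0) ∧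
    ∀ U : Submodule ℂ M, (∀ (u : V) (n : ℤ) (w : M), w ∈ U → P.act u n w ∈ U) →
      U = ⊥ ∨ U = ⊤

/-- Isomorphism of two weak modules over the same vertex operator algebra. -/
def ModIso (A : VOA V) {M N : Type} [AddCommGroup M] [Module ℂ M]
    [AddCommGroup N] [Module ℂ N] (P : WkMod A M) (Q : WkMod A N) : Prop :=
  ∃ f : M ≃ₗ[ℂ] N, ∀ (u : V) (n : ℤ) (w : M), f (P.act u n w) = Q.act u n (f w)

/-- The action of the zero-mode `o(u) = u_{wt u - 1}` (extended linearly from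
homogeneous vectors) on a weak module; it preserves the top level of an
admissible module. -/
noncomputable def WkMod.oAct {A : VOA V} {M : Type} [AddCommGroup M] [Module ℂ M]
    (Q : WkMod A M) (u : V) (w : M) : M :=
  ∑ᶠ k : ℤ, Q.act (A.hcomp k u) (k - 1) w

/-- Action of a word of creation operators `h_{a_1}(-n_1) ⋯ h_{a_k}(-n_k)`. -/
def wordAct {ℓ : ℕ} {M : Type} (f : Fin ℓ → ℤ → M → M) : List (Fin ℓ × ℕ+) → M → M
  | [], w => w
  | (a, n) :: L, w => f a (-((n : ℕ) : ℤ)) (wordAct f L w)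

/-- Action of a word of twisted creation operators
`h_{a_1}(-n_1+1/2) ⋯ h_{a_k}(-n_k+1/2)` (indices doubled). -/
def twWordAct {ℓ : ℕ} {M : Type} (f : Fin ℓ → ℤ → M → M) : List (Fin ℓ × ℕ+) → M → M
  | [], w => w
  | (a, n) :: L, w => f a (-(2 * ((n : ℕ) : ℤ) - 1)) (twWordAct f L w)

/-- `A` is the rank `ℓ` free bosonic (Heisenberg) vertex operator algebra
`𝓗 = M(1)`, with generators `hgen a = h_a(-1)𝟏` for an orthonormal basis
`h_1, …, h_ℓ` of `𝔥`: the generators have weight one, their modes satisfy the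
Heisenberg commutation relations `[h_a(m), h_b(n)] = m δ_{ab} δ_{m+n,0}`, the
conformal vector is `ω = (1/2) ∑_a h_a(-1)²𝟏`, and `V` is spanned by the vectors
`h_{a_1}(-n_1) ⋯ h_{a_k}(-n_k)𝟏`. -/
structure IsHeisenberg {ℓ : ℕ} (A : VOA V) (hgen : Fin ℓ → V) : Prop where
  wt_one : ∀ a, hgen a ∈ A.wt 1
  heis_comm : ∀ (a b : Fin ℓ) (m n : ℤ),
    A.Y (hgen a) m * A.Y (hgen b) n - A.Y (hgen b) n * A.Y (hgen a) m
      = (if a = b ∧ m + n = 0 then (m : ℂ) else 0) • (1 : Module.End ℂ V)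
  omega_eq : A.omega
      = (1 / 2 : ℂ) • ∑ a : Fin ℓ, A.Y (hgen a) (-1) (A.Y (hgen a) (-1) A.one)
  span_words : Submodule.span ℂ
      {v : V | ∃ L : List (Fin ℓ × ℕ+),
        v = wordAct (fun a k w => A.Y (hgen a) k w) L A.one} = ⊤

/-- `θ` is the automorphism of the free bosonic vertex operator algebra induced
by `-1` on `𝔥`. -/
structure IsThetaAut {ℓ : ℕ} (A : VOA V) (hgen : Fin ℓ → V) (θ : V ≃ₗ[ℂ] V) : Prop where
  map_one : θ A.one = A.one
  map_omega : θ A.omega = A.omega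
  map_Y : ∀ (u : V) (n : ℤ) (v : V), θ (A.Y u n v) = A.Y (θ u) n (θ v)
  map_gen : ∀ a, θ (hgen a) = -hgen a
  map_wt : ∀ (k : ℤ) (v : V), v ∈ A.wt k → θ v ∈ A.wt k

/-- `B` (with underlying space `W`, embedded in `V` by `ι`) is the fixed point
vertex operator subalgebra `V^θ` of the involution `θ`. -/
structure IsFixedSubVOA {W : Type} [AddCommGroup W] [Module ℂ W]
    (A : VOA V) (θ : V ≃ₗ[ℂ] V) (B : VOA W) (ι : W →ₗ[ℂ] V) : Prop where
  inj : Function.Injective ι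
  range_eq : LinearMap.range ι
      = Module.End.eigenspace (θ.toLinearMap : Module.End ℂ V) 1
  map_one : ι B.one = A.one
  map_omega : ι B.omega = A.omega
  map_Y : ∀ (u : W) (n : ℤ) (v : W), ι (B.Y u n v) = A.Y (ι u) n (ι v)
  map_wt : ∀ (k : ℤ) (w : W), w ∈ B.wt k ↔ ι w ∈ A.wt k

/-- `P` is (isomorphic to) the Fock module `M(1,λ)` over the rank `ℓ` Heisenberg
vertex operator algebra: it has a nonzero vector `v₀` with `h_a(n)v₀ = 0` for
`n ≥ 1`, `h_a(0)v₀ = λ_a v₀`, which generates `M` under the creation operators. -/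
def IsFockModule {ℓ : ℕ} {M : Type} [AddCommGroup M] [Module ℂ M]
    (A : VOA V) (hgen : Fin ℓ → V) (P : WkMod A M) (lam : Fin ℓ → ℂ) : Prop :=
  ∃ v0 : M, v0 ≠ 0 ∧ (∀ (a : Fin ℓ) (n : ℤ), 1 ≤ n → P.act (hgen a) n v0 = 0) ∧
    (∀ a : Fin ℓ, P.act (hgen a) 0 v0 = lam a • v0) ∧
    Submodule.span ℂ {w : M | ∃ L : List (Fin ℓ × ℕ+),
      w = wordAct (fun a k x => P.act (hgen a) k x) L v0} = ⊤

/-- A weak `θ`-twisted module (for an involution `θ`): the modes are indexed by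
`(1/2)ℤ`, encoded here by doubling (so `act u k` is the mode `u_{k/2}`); on the
eigenspace `θ = (-1)^r` only modes with `k ≡ r (mod 2)` act, and the component
form of the twisted Jacobi identity holds. -/
structure TwMod (A : VOA V) (θ : V ≃ₗ[ℂ] V) (M : Type) [AddCommGroup M]
    [Module ℂ M] : Type where
  act : V →ₗ[ℂ] ℤ → Module.End ℂ M
  trunc : ∀ (u : V) (w : M), ∃ N : ℤ, ∀ n : ℤ, N ≤ n → act u n w = 0
  vacuum_act : ∀ n : ℤ, act A.one n = if n = -2 then (1 : Module.End ℂ M) else 0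
  moding : ∀ (u : V) (r : ℤ), θ u = ((-1 : ℂ) ^ r) • u →
    ∀ k : ℤ, (k - r) % 2 ≠ 0 → act u k = 0
  borcherds : ∀ (u v : V) (r s : ℤ), θ u = ((-1 : ℂ) ^ r) • u →
    θ v = ((-1 : ℂ) ^ s) • v → ∀ (w : M) (p K N : ℤ),
    ∑ᶠ i : ℕ, ((qchoose ((K : ℚ) / 2) i : ℚ) : ℂ) • act (A.Y u (p + i) v) (K + N - 2 * i) w
      = ∑ᶠ i : ℕ, ((-1 : ℂ) ^ i * zchoose p i) •
          (act u (K + 2 * p - 2 * i) (act v (N + 2 * i) w)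
            - ((-1 : ℂ) ^ p) • act v (N + 2 * p - 2 * i) (act u (K + 2 * i) w))

/-- Irreducibility of a twisted module. -/
def TwMod.Irreducible {A : VOA V} {θ : V ≃ₗ[ℂ] V} {M : Type} [AddCommGroup M]
    [Module ℂ M] (T : TwMod A θ M) : Prop :=
  (∃ w : M, w ≠ 0) ∧
    ∀ U : Submodule ℂ M, (∀ (u : V) (k : ℤ) (w : M), w ∈ U → T.act u k w ∈ U) →
      U = ⊥ ∨ U = ⊤

/-- `T` is (isomorphic to) the canonical irreducible `θ`-twisted module
`𝓗(θ) = S(𝔥 ⊗ t^{-1/2}ℂ[t^{-1/2}])` of the rank `ℓ` free bosonic vertex operator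
algebra: it has a nonzero vector killed by all modes `h_a(k/2)`, `k ≥ 1`, which
generates it under the twisted creation operators. -/
def IsCanonicalTwMod {ℓ : ℕ} {M : Type} [AddCommGroup M] [Module ℂ M]
    (A : VOA V) (hgen : Fin ℓ → V) {θ : V ≃ₗ[ℂ] V} (T : TwMod A θ M) : Prop :=
  ∃ v0 : M, v0 ≠ 0 ∧ (∀ (a : Fin ℓ) (k : ℤ), 1 ≤ k → T.act (hgen a) k v0 = 0) ∧
    Submodule.span ℂ {w : M | ∃ L : List (Fin ℓ × ℕ+),
      w = twWordAct (fun a k x => T.act (hgen a) k x) L v0} = ⊤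

/-- `σ` is the canonical involution of the twisted module `𝓗(θ)` (acting by
`(-1)^k` on monomials of length `k`): it is an involution compatible with `θ`
through the twisted action and fixing the lowest weight vectors. -/
def TwInvolution {ℓ : ℕ} {M : Type} [AddCommGroup M] [Module ℂ M]
    (A : VOA V) (hgen : Fin ℓ → V) {θ : V ≃ₗ[ℂ] V} (T : TwMod A θ M)
    (σ : M ≃ₗ[ℂ] M) : Prop :=
  (∀ w : M, σ (σ w) = w) ∧
  (∀ (u : V) (k : ℤ) (w : M), σ (T.act u k w) = T.act (θ u) k (σ w)) ∧
  (∀ v0 : M, (∀ (a : Fin ℓ) (k : ℤ), 1 ≤ k → T.act (hgen a) k v0 = 0) → σ v0 = v0)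

/-- The weak `B = V^θ`-module `Q` "is" the eigenspace `V^{(ε)}` of `θ` on `V`
(e.g. `𝓗⁺` itself for `ε = 1` and `𝓗⁻` for `ε = -1`), with action obtained by
restricting the vertex operators of `V`. -/
def IsEigenPartModule {W N : Type} [AddCommGroup W] [Module ℂ W]
    [AddCommGroup N] [Module ℂ N] (A : VOA V) (θ : V ≃ₗ[ℂ] V) {B : VOA W}
    (ι : W →ₗ[ℂ] V) (ε : ℂ) (Q : WkMod B N) : Prop :=
  ∃ j : N →ₗ[ℂ] V, Function.Injective j ∧
    LinearMap.range j = Module.End.eigenspace (θ.toLinearMap : Module.End ℂ V) ε ∧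
    ∀ (u : W) (n : ℤ) (w : N), j (Q.act u n w) = A.Y (ι u) n (j w)

/-- The weak `B = V^θ`-module `Q` "is" the eigenspace `𝓗(θ)^{(ε)}` of the
involution `σ` on the twisted module `𝓗(θ)`, with the restricted twisted action
(`u ∈ V^θ` acts by its integral modes). -/
def IsTwEigenPartModule {W MT N : Type} [AddCommGroup W] [Module ℂ W]
    [AddCommGroup MT] [Module ℂ MT] [AddCommGroup N] [Module ℂ N]
    (A : VOA V) {θ : V ≃ₗ[ℂ] V} {B : VOA W} (ι : W →ₗ[ℂ] V)
    (T : TwMod A θ MT) (σ : MT ≃ₗ[ℂ] MT) (ε : ℂ) (Q : WkMod B N) : Prop :=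
  ∃ j : N →ₗ[ℂ] MT, Function.Injective j ∧
    LinearMap.range j = Module.End.eigenspace (σ.toLinearMap : Module.End ℂ MT) ε ∧
    ∀ (u : W) (n : ℤ) (w : N), j (Q.act u n w) = T.act (ι u) (2 * n) (j w)

/-- The weak `B = 𝓗⁺`-module `Q` "is" the restriction to `𝓗⁺` of the Fock module
`M(1,λ)`. -/
def IsFockRestriction {ℓ : ℕ} {W N : Type} [AddCommGroup W] [Module ℂ W]
    [AddCommGroup N] [Module ℂ N] (A : VOA V) (hgen : Fin ℓ → V) {B : VOA W}
    (ι : W →ₗ[ℂ] V) (lam : Fin ℓ → ℂ) (Q : WkMod B N) : Prop :=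
  ∃ P : WkMod A N, IsFockModule A hgen P lam ∧
    ∀ (u : W) (n : ℤ), Q.act u n = P.act (ι u) n

/-- A realization of Zhu's algebra `A(V) = V/O(V)` of a vertex operator algebra
as an abstract associative `ℂ`-algebra `R`. -/
structure ZhuRealization (A : VOA V) (R : Type) [Ring R] [Algebra ℂ R] : Type where
  π : V →ₗ[ℂ] R
  surj : Function.Surjective π
  ker_eq : LinearMap.ker π = A.Osub
  map_star : ∀ u v : V, π (A.star u v) = π u * π v
  map_one : π A.one = 1

/-- The `R = A(V)`-module `M` "is" the top level `N(0)` of the admissible module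
`N`, where `[u] ∈ A(V)` acts on the top level by the zero-mode `o(u)`. -/
def IsTopLevelOf {R : Type} [Ring R] [Algebra ℂ R] {A : VOA V}
    (Z : ZhuRealization A R) {N : Type} [AddCommGroup N] [Module ℂ N]
    (Qa : AdmMod A N) (M : Type) [AddCommGroup M] [Module R M] : Prop :=
  ∃ f : M →+ N, Function.Injective f ∧ (∀ m : M, f m ∈ Qa.gr 0) ∧
    (∀ w ∈ Qa.gr 0, ∃ m : M, f m = w) ∧
    ∀ (u : V) (m : M), f (Z.π u • m) = Qa.toWkMod.oAct u (f m)

/-- Iterated Zhu product of a list of elements (an empty product is `[𝟏]`). -/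
noncomputable def starList (A : VOA V) : List V → V
  | [] => A.one
  | x :: L => A.star x (starList A L)

/-- The linear span of all Zhu-monomials in a set of generators; modulo `O(V)`
this is the subalgebra of `A(V)` generated by the images of the generators. -/
def genMonomials (A : VOA V) (gens : Set V) : Submodule ℂ V :=
  Submodule.span ℂ {w : V | ∃ L : List V, (∀ g ∈ L, g ∈ gens) ∧ w = starList A L}

/-- The subspace `𝓦^α ⊆ 𝓗` spanned by the monomials
`h_{a_1}(-n_1) ⋯ h_{a_k}(-n_k)𝟏` whose number of letters from `𝓗_c` is odd
exactly for `c ∈ α`; thus `wordSpanV A hgen ∅ = 𝓦 = 𝓗₁⁺ ⊗ ⋯ ⊗ 𝓗_ℓ⁺`. -/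
def wordSpanV {ℓ : ℕ} (A : VOA V) (hgen : Fin ℓ → V) (α : Finset (Fin ℓ)) :
    Submodule ℂ V :=
  Submodule.span ℂ {v : V | ∃ L : List (Fin ℓ × ℕ+),
    (∀ c : Fin ℓ, c ∈ α ↔ ¬ Even ((L.map Prod.fst).count c)) ∧
    v = wordAct (fun a k w => A.Y (hgen a) k w) L A.one}

/-- The element `S_{ab}(m,n) = h_a(-m)h_b(-n)𝟏` of `𝓗`. -/
def SV {ℓ : ℕ} (A : VOA V) (hgen : Fin ℓ → V) (a b : Fin ℓ) (m n : ℤ) : V :=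
  A.Y (hgen a) (-m) (A.Y (hgen b) (-n) A.one)

/-- The element `ω_a = (1/2) h_a(-1)²𝟏` of `𝓗⁺`. -/
def omegaV {ℓ : ℕ} (A : VOA V) (hgen : Fin ℓ → V) (a : Fin ℓ) : V :=
  (1 / 2 : ℂ) • SV A hgen a a 1 1

/-- The element `J_a = h_a(-1)⁴𝟏 - 2h_a(-3)h_a(-1)𝟏 + (3/2)h_a(-2)²𝟏` of `𝓗⁺`. -/
def JV {ℓ : ℕ} (A : VOA V) (hgen : Fin ℓ → V) (a : Fin ℓ) : V :=
  A.Y (hgen a) (-1) (A.Y (hgen a) (-1) (A.Y (hgen a) (-1) (A.Y (hgen a) (-1) A.one)))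
    - (2 : ℂ) • SV A hgen a a 3 1 + (3 / 2 : ℂ) • SV A hgen a a 2 2

variable {W : Type} [AddCommGroup W] [Module ℂ W]

/-- `E^u_{ab}` (for `a ≠ b`), as a combination of the `S_{ab}(1,m)`. -/
def EuW {ℓ : ℕ} (s : Fin ℓ → Fin ℓ → ℤ → ℤ → W) (a b : Fin ℓ) : W :=
  (5 : ℂ) • s a b 1 2 + (25 : ℂ) • s a b 1 3 + (36 : ℂ) • s a b 1 4 + (16 : ℂ) • s a b 1 5

/-- `E^t_{ab}` (for `a ≠ b`), as a combination of the `S_{ab}(1,m)`. -/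
def EtW {ℓ : ℕ} (s : Fin ℓ → Fin ℓ → ℤ → ℤ → W) (a b : Fin ℓ) : W :=
  (-16 : ℂ) • ((3 : ℂ) • s a b 1 2 + (14 : ℂ) • s a b 1 3 + (19 : ℂ) • s a b 1 4
    + (8 : ℂ) • s a b 1 5)

/-- `Λ_{ab}` (for `a ≠ b`), as a combination of the `S_{ab}(1,m)`. -/
def LamW {ℓ : ℕ} (s : Fin ℓ → Fin ℓ → ℤ → ℤ → W) (a b : Fin ℓ) : W :=
  (45 : ℂ) • s a b 1 2 + (190 : ℂ) • s a b 1 3 + (240 : ℂ) • s a b 1 4 + (96 : ℂ) • s a b 1 5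

/-- The full setting of the paper: `A = 𝓗` is the rank `ℓ` free bosonic vertex
operator algebra with Heisenberg generators `hgen`, `θ` is its `-1` involution,
and `B = 𝓗⁺` is the fixed point vertex operator subalgebra, embedded by `ι`. -/
structure HeisenbergPlusSetting (ℓ : ℕ) (V W : Type) [AddCommGroup V] [Module ℂ V]
    [AddCommGroup W] [Module ℂ W] : Type where
  A : VOA V
  hgen : Fin ℓ → V
  heis : IsHeisenberg A hgen
  θ : V ≃ₗ[ℂ] V
  thetaAut : IsThetaAut A hgen θ
  B : VOA W
  ι : W →ₗ[ℂ] V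
  fixedSub : IsFixedSubVOA A θ B ι

/-- Bundled weak module over a vertex operator algebra. -/
structure ARep (A : VOA V) : Type 1 where
  carrier : Type
  [acg : AddCommGroup carrier]
  [mod : Module ℂ carrier]
  str : WkMod A carrier

attribute [instance] ARep.acg ARep.mod

/-- Bundled admissible module over a vertex operator algebra. -/
structure BRep (A : VOA V) : Type 1 where
  carrier : Type
  [acg : AddCommGroup carrier]
  [mod : Module ℂ carrier]
  adm : AdmMod A carrier

attribute [instance] BRep.acg BRep.mod

/-- Bundled twisted module over a vertex operator algebra with involution. -/
structure TwRep (A : VOA V) (θ : V ≃ₗ[ℂ] V) : Type 1 where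
  carrier : Type
  [acg : AddCommGroup carrier]
  [mod : Module ℂ carrier]
  str : TwMod A θ carrier

attribute [instance] TwRep.acg TwRep.mod

end


namespace Zhu
open Finset
set_option linter.unusedSimpArgs false

theorem qchoose_nat (k n : ℕ) : qchoose (k : ℚ) n = (k.choose n : ℚ) := by
  induction n with
  | zero => simp [qchoose]
  | succ n ih =>
    rw [qchoose, ih]
    have h1 : ((n : ℚ) + 1) ≠ 0 := by positivity
    rw [div_eq_iff h1]
    have := Nat.choose_succ_right_eq k n
    rcases le_or_gt n k with h | h
    · have h2 : ((k.choose (n + 1) * (n + 1) : ℕ) : ℚ) = ((k.choose n * (k - n) : ℕ) : ℚ) := by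
        rw [this]
      push_cast [Nat.cast_sub h] at h2
      linarith
    · rw [Nat.choose_eq_zero_of_lt h, Nat.choose_eq_zero_of_lt (by omega)]
      simp

theorem zchoose_nat (k n : ℕ) : zchoose (k : ℤ) n = (k.choose n : ℂ) := by
  unfold zchoose
  have := qchoose_nat k n
  simp only [Int.cast_natCast, this]
  simp

theorem qchoose_pascal (q : ℚ) (n : ℕ) :
    qchoose (q + 1) (n + 1) = qchoose q (n + 1) + qchoose q n := by
  induction n with
  | zero => simp [qchoose]
  | succ n ih =>
    rw [qchoose, ih, qchoose.eq_2 q (n + 1), qchoose.eq_2 q n]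
    have h1 : ((n : ℚ) + 1) ≠ 0 := by positivity
    have h2 : ((n : ℚ) + 1 + 1) ≠ 0 := by positivity
    push_cast
    field_simp
    ring

theorem zchoose_pascal (p : ℤ) (n : ℕ) :
    zchoose (p + 1) (n + 1) = zchoose p (n + 1) + zchoose p n := by
  unfold zchoose
  have := qchoose_pascal (p : ℚ) n
  push_cast
  rw [this]
  push_cast
  rfl

@[simp] theorem zchoose_zero (p : ℤ) : zchoose p 0 = 1 := by
  simp [zchoose, qchoose]

theorem zchoose_succ (p : ℤ) (n : ℕ) :
    zchoose p (n + 1) * (n + 1) = zchoose p n * (p - n) := by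
  unfold zchoose
  rw [qchoose]
  have h1 : ((n : ℂ) + 1) ≠ 0 := by exact_mod_cast Nat.succ_ne_zero n
  push_cast
  field_simp

theorem zchoose_zero_left (n : ℕ) (hn : n ≠ 0) : zchoose 0 n = 0 := by
  have := zchoose_nat 0 n
  simp only [Nat.cast_zero] at this
  rw [this, Nat.choose_eq_zero_of_lt (Nat.pos_of_ne_zero hn)]
  simp

/-- Vandermonde. -/
theorem vander (l : ℕ) : ∀ (c : ℤ) (n : ℕ),
    ∑ x ∈ antidiagonal n, (l.choose x.1 : ℂ) * zchoose c x.2 = zchoose (c + l) n := by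
  induction l with
  | zero =>
    intro c n
    cases n with
    | zero => simp
    | succ n =>
      rw [Finset.Nat.antidiagonal_succ]
      simp
  | succ l ih =>
    intro c n
    cases n with
    | zero => simp
    | succ n =>
      have e : (c + ((l + 1 : ℕ) : ℤ)) = (c + l) + 1 := by push_cast; ring
      rw [e, zchoose_pascal, ← ih c n, ← ih c (n + 1), Finset.Nat.sum_antidiagonal_succ,
        Finset.Nat.sum_antidiagonal_succ]
      simp only [Nat.choose_succ_succ, Nat.cast_add, add_mul, Finset.sum_add_distrib,
        Nat.choose_zero_right]
      ring

theorem zchoose_neg (x : ℤ) (n : ℕ) :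
    zchoose (-x) n = (-1) ^ n * zchoose (x + n - 1) n := by
  induction n generalizing x with
  | zero => simp
  | succ n ih =>
    have h1 : ((n : ℂ) + 1) ≠ 0 := by exact_mod_cast Nat.succ_ne_zero n
    apply mul_right_cancel₀ h1
    rw [zchoose_succ, mul_assoc, zchoose_succ, ih x]
    -- (x+n-1 choose n) * (-x-n) vs (x+n choose n) * (x)
    have key : zchoose (x + n - 1) n * (x + n) = zchoose (x + n) n * x := by
      clear ih h1
      have gen : ∀ (m : ℕ) (y : ℤ), zchoose y m * (y + 1) = zchoose (y + 1) m * (y + 1 - m) := by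
        intro m
        induction m with
        | zero => intro y; simp
        | succ m ihm =>
          intro y
          have h1 : ((m : ℂ) + 1) ≠ 0 := by exact_mod_cast Nat.succ_ne_zero m
          apply mul_right_cancel₀ h1
          have e1 := zchoose_succ y m
          have e2 := zchoose_succ (y + 1) m
          have e3 := ihm y
          push_cast at e2 ⊢
          linear_combination (y + 1 : ℂ) * e1 - (y + 1 - (m + 1) : ℂ) * e2 + (y - m : ℂ) * e3
      have := gen n (x + n - 1)
      have e : x + n - 1 + 1 = x + n := by ring
      rw [e] at this
      push_cast at this
      linear_combination this
    have e : x + ((n + 1 : ℕ) : ℤ) - 1 = x + n := by push_cast; ring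
    rw [e]
    push_cast
    rw [pow_succ]
    linear_combination (-(-1) ^ n) * key

section
variable {V : Type} [AddCommGroup V] [Module ℂ V] (A : VOA V)

/-- `Res (1+z)^k z^q Y(u,z)`. -/
noncomputable def RR (k : ℕ) (q : ℤ) : V →ₗ[ℂ] Module.End ℂ V :=
  ∑ i ∈ range (k + 1), (k.choose i : ℂ) • ((LinearMap.proj ((i : ℤ) + q)).comp A.Y)

theorem RR_apply (k : ℕ) (q : ℤ) (u v : V) :
    RR A k q u v = ∑ i ∈ range (k + 1), (k.choose i : ℂ) • A.Y u ((i : ℤ) + q) v := by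
  simp [RR]

theorem RR_zero (q : ℤ) (u : V) : RR A 0 q u = A.Y u q := by
  simp [RR]

theorem RR_pascal (k : ℕ) (q : ℤ) : RR A (k + 1) q = RR A k q + RR A k (q + 1) := by
  unfold RR
  rw [Finset.sum_range_succ' _ (k + 1)]
  have h : ∑ i ∈ range (k + 1), (k.choose i : ℂ) • ((LinearMap.proj ((i : ℤ) + q)).comp A.Y)
      = ∑ i ∈ range (k + 1), (k.choose (i+1) : ℂ) • ((LinearMap.proj (((i + 1 : ℕ) : ℤ) + q)).comp A.Y)
        + (LinearMap.proj q).comp A.Y := by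
    have := Finset.sum_range_succ' (fun i : ℕ => (k.choose i : ℂ) • ((LinearMap.proj (R := ℂ)
      (φ := fun _ : ℤ => Module.End ℂ V) ((i : ℤ) + q)).comp A.Y)) (k + 1)
    rw [Finset.sum_range_succ] at this
    simp only [Nat.choose_succ_self, Nat.cast_zero, zero_smul, add_zero, Nat.choose_zero_right,
      Nat.cast_one, one_smul, zero_add] at this
    exact this
  rw [h]
  simp only [Nat.choose_succ_succ, Nat.cast_add, add_smul, Finset.sum_add_distrib,
    Nat.choose_zero_right, Nat.cast_one, one_smul, Nat.cast_zero, zero_add]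
  have h2 : ∀ i : ℕ, ((i : ℤ) + (q + 1)) = (i : ℤ) + 1 + q := fun i => by ring
  simp only [h2]
  abel

theorem RR_trunc (k : ℕ) (u v : V) : ∃ N : ℕ, ∀ q : ℤ, (N : ℤ) ≤ q → RR A k q u v = 0 := by
  obtain ⟨N, hN⟩ := A.trunc u v
  refine ⟨N.toNat, fun q hq => ?_⟩
  rw [RR_apply]
  refine Finset.sum_eq_zero fun i _ => ?_
  rw [hN _ (by omega), smul_zero]

/-- Left side of the iterated identity. -/
noncomputable def LL (u v w : V) : ℕ → ℕ → ℤ → ℤ → V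
  | 0, l, p, q => RR A l q (A.Y u p v) w
  | k + 1, l, p, q => LL u v w k (l + 1) p q + LL u v w k l (p + 1) q

theorem sum_aux (p : ℤ) (F : ℕ → V) (N : ℕ) (hF : F N = 0) :
    ∑ j ∈ range N, ((-1 : ℂ) ^ j * zchoose (p + 1) j) • F j
      = ∑ j ∈ range N, ((-1 : ℂ) ^ j * zchoose p j) • F j
        - ∑ j ∈ range N, ((-1 : ℂ) ^ j * zchoose p j) • F (j + 1) := by
  cases N with
  | zero => simp
  | succ N =>
    conv_rhs => rw [Finset.sum_range_succ (fun j => ((-1 : ℂ) ^ j * zchoose p j) • F (j + 1))]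
    rw [hF, smul_zero, add_zero, Finset.sum_range_succ', Finset.sum_range_succ' _ N]
    simp only [zchoose_pascal, pow_zero, zchoose_zero, mul_one]
    rw [add_sub_right_comm, ← Finset.sum_sub_distrib]
    congr 1
    refine Finset.sum_congr rfl fun j _ => ?_
    rw [pow_succ]
    module

theorem ident (u v w : V) (k : ℕ) : ∀ (l : ℕ) (p q : ℤ), ∃ N0 : ℕ, ∀ N : ℕ, N0 ≤ N →
    LL A u v w k l p q = ∑ j ∈ range N, ((-1 : ℂ) ^ j * zchoose p j) •
      (RR A k (p - j) u (RR A l (q + j) v w)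
        - ((-1 : ℂ) ^ p) • RR A l (q + p - j) v (RR A k j u w)) := by
  induction k with
  | zero =>
    intro l
    induction l with
    | zero =>
      intro p q
      obtain ⟨N1, h1⟩ := A.trunc v w
      obtain ⟨N2, h2⟩ := A.trunc u w
      refine ⟨(N1 - q).toNat + N2.toNat, fun N hN => ?_⟩
      have hb := A.borcherds u v w p 0 q
      rw [finsum_eq_single _ 0 (fun i hi => by rw [zchoose_zero_left i hi, zero_smul])] at hb
      simp only [zchoose_zero, one_smul, Nat.cast_zero, add_zero, sub_zero, zero_add] at hb
      simp only [LL, RR_zero]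
      rw [hb]
      apply finsum_eq_sum_of_support_subset
      intro j hj
      by_contra hj'
      apply hj
      have : N ≤ j := by simpa using hj'
      simp only
      rw [h1 _ (by omega), h2 _ (by omega)]
      simp
    | succ l ih =>
      intro p q
      obtain ⟨N1, h1⟩ := ih p q
      obtain ⟨N2, h2⟩ := ih p (q + 1)
      refine ⟨N1 + N2, fun N hN => ?_⟩
      have e1 := h1 N (by omega)
      have e2 := h2 N (by omega)
      simp only [LL] at e1 e2 ⊢
      rw [RR_pascal, LinearMap.add_apply, LinearMap.add_apply, e1, e2, ← Finset.sum_add_distrib]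
      refine Finset.sum_congr rfl fun j _ => ?_
      rw [RR_pascal, RR_pascal]
      simp only [LinearMap.add_apply, map_add]
      have a1 : q + 1 + (j : ℤ) = q + j + 1 := by ring
      have a2 : q + 1 + p - (j : ℤ) = q + p - j + 1 := by ring
      rw [a1, a2]
      module
  | succ k ih =>
    intro l p q
    obtain ⟨N1, h1⟩ := ih (l + 1) p q
    obtain ⟨N2, h2⟩ := ih l (p + 1) q
    obtain ⟨N3, h3⟩ := RR_trunc A l v w
    obtain ⟨N4, h4⟩ := RR_trunc A k u w
    refine ⟨N1 + N2 + (N3 + (-q).toNat) + N4, fun N hN => ?_⟩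
    rw [LL, h1 N (by omega), h2 N (by omega)]
    have hF := sum_aux p (fun j => RR A k (p + 1 - j) u (RR A l (q + j) v w)) N
      (by rw [h3 _ (by omega)]; simp)
    have hG := sum_aux p (fun j => RR A l (q + (p + 1) - j) v (RR A k j u w)) N
      (by rw [h4 _ (by omega)]; simp)
    simp only [smul_sub, Finset.sum_sub_distrib] at *
    rw [hF]
    have hG' : ∑ j ∈ range N, ((-1 : ℂ) ^ j * zchoose (p + 1) j) • ((-1 : ℂ) ^ (p + 1)) •
        RR A l (q + (p + 1) - j) v (RR A k j u w) = ((-1 : ℂ) ^ (p + 1)) •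
        ∑ j ∈ range N, ((-1 : ℂ) ^ j * zchoose (p + 1) j) •
        RR A l (q + (p + 1) - j) v (RR A k j u w) := by
      rw [Finset.smul_sum]
      refine Finset.sum_congr rfl fun j _ => ?_
      rw [smul_comm]
    rw [hG', hG, zpow_add_one₀ (by norm_num)]
    simp only [smul_sub, Finset.smul_sum, ← Finset.sum_sub_distrib, ← Finset.sum_add_distrib]
    refine Finset.sum_congr rfl fun j _ => ?_
    simp only [RR_pascal, LinearMap.add_apply, map_add]
    have a1 : p + 1 - ((j + 1 : ℕ) : ℤ) = p - j := by push_cast; ring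
    have a2 : q + ((j + 1 : ℕ) : ℤ) = q + j + 1 := by push_cast; ring
    have a3 : q + (p + 1) - ((j + 1 : ℕ) : ℤ) = q + p - j := by push_cast; ring
    have a4 : p + 1 - (j : ℤ) = p - j + 1 := by ring
    have a5 : q + (p + 1) - (j : ℤ) = q + p - j + 1 := by ring
    rw [a1, a2, a3, a4, a5]
    push_cast
    module

end
end Zhu


namespace Zhu
open Finset
set_option linter.unusedSimpArgs false

theorem zchoose_shift (m : ℕ) (y : ℤ) :
    zchoose y m * (y + 1) = zchoose (y + 1) m * (y + 1 - m) := by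
  induction m with
  | zero => simp
  | succ m ihm =>
    have h1 : ((m : ℂ) + 1) ≠ 0 := by exact_mod_cast Nat.succ_ne_zero m
    apply mul_right_cancel₀ h1
    have e1 := zchoose_succ y m
    have e2 := zchoose_succ (y + 1) m
    push_cast at e2 ⊢
    linear_combination (y + 1 : ℂ) * e1 - (y + 1 - (m + 1) : ℂ) * e2 + (y - m : ℂ) * ihm

section
variable {V : Type} [AddCommGroup V] [Module ℂ V] (A : VOA V)

theorem mulAux_eq (k : ℕ) (u v : V) : A.mulAux k u v = RR A k (-1) u v := by
  unfold VOA.mulAux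
  rw [RR_apply]
  have : ∀ i : ℕ, zchoose (k : ℤ) i • A.Y u ((i : ℤ) - 1) v
      = (k.choose i : ℂ) • A.Y u ((i : ℤ) + (-1)) v := by
    intro i; rw [zchoose_nat]; rfl
  simp only [this]
  apply finsum_eq_sum_of_support_subset
  intro i hi
  by_contra h
  apply hi
  have h' : k < i := by
    by_contra h2
    apply h
    simp only [coe_range, Set.mem_Iio]; omega
  simp [Nat.choose_eq_zero_of_lt h']

theorem circAux_eq (k : ℕ) (u v : V) : A.circAux k u v = RR A k (-2) u v := by
  unfold VOA.circAux
  rw [RR_apply]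
  have : ∀ i : ℕ, zchoose (k : ℤ) i • A.Y u ((i : ℤ) - 2) v
      = (k.choose i : ℂ) • A.Y u ((i : ℤ) + (-2)) v := by
    intro i; rw [zchoose_nat]; rfl
  simp only [this]
  apply finsum_eq_sum_of_support_subset
  intro i hi
  by_contra h
  apply hi
  have h' : k < i := by
    by_contra h2
    apply h
    simp only [coe_range, Set.mem_Iio]; omega
  simp [Nat.choose_eq_zero_of_lt h']

/-- Linear version of the Zhu product. -/
noncomputable def StarL : V →ₗ[ℂ] Module.End ℂ V :=
  (DirectSum.toModule ℂ ℤ (Module.End ℂ V)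
    (fun k => (RR A k.toNat (-1)).comp (A.wt k).subtype)).comp A.decompose.toLinearMap

theorem decompose_of_mem {k : ℤ} {u : V} (hu : u ∈ A.wt k) :
    A.decompose u = DirectSum.lof ℂ ℤ (fun n => A.wt n) k ⟨u, hu⟩ := by
  unfold VOA.decompose
  rw [LinearEquiv.symm_apply_eq]
  exact (DirectSum.coeLinearMap_lof A.wt k ⟨u, hu⟩).symm

theorem StarL_mem {k : ℕ} {u : V} (hu : u ∈ A.wt k) : StarL A u = RR A k (-1) u := by
  unfold StarL
  simp only [LinearMap.comp_apply, LinearEquiv.coe_coe]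
  rw [decompose_of_mem A hu, DirectSum.toModule_lof]
  simp

theorem star_eq (hneg : ∀ k : ℤ, k < 0 → A.wt k = ⊥) (u v : V) :
    A.star u v = StarL A u v := by
  classical
  unfold VOA.star StarL
  have h : ∀ k : ℤ, A.mulAux k (A.hcomp k u) v = RR A k.toNat (-1) (A.decompose u k : V) v := by
    intro k
    rcases lt_or_ge k 0 with hk | hk
    · have h0 : ((A.decompose u k : A.wt k) : V) = 0 := by
        have := (A.decompose u k).2
        have h2 : ∀ x ∈ A.wt k, x = 0 := by rw [hneg k hk]; simp
        exact h2 _ this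
      unfold VOA.hcomp
      rw [h0]
      unfold VOA.mulAux
      simp
    · obtain ⟨n, rfl⟩ := Int.eq_ofNat_of_zero_le hk
      rw [mulAux_eq]
      rfl
  simp only [h]
  simp only [LinearMap.comp_apply, LinearEquiv.coe_coe]
  have e : (DirectSum.toModule ℂ ℤ (Module.End ℂ V)
      fun k => RR A k.toNat (-1) ∘ₗ (A.wt k).subtype) (A.decompose u)
      = ∑ k ∈ DFinsupp.support (A.decompose u), RR A k.toNat (-1) (A.decompose u k : V) := by
    conv_lhs => rw [← DirectSum.sum_support_of (A.decompose u)]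
    rw [map_sum]
    refine Finset.sum_congr rfl fun k _ => ?_
    exact (DirectSum.toModule_lof ℂ (φ := fun k => RR A k.toNat (-1) ∘ₗ (A.wt k).subtype) k (A.decompose u k))
  rw [e, LinearMap.sum_apply]
  apply finsum_eq_sum_of_support_subset
  intro k hk
  by_contra h'
  apply hk
  have : A.decompose u k = 0 := by simpa using h'
  simp [this]

theorem hom_ind (hneg : ∀ k : ℤ, k < 0 → A.wt k = ⊥) {P : V → Prop} (v : V)
    (hm : ∀ (k : ℕ) (u : V), u ∈ A.wt k → P u) (hadd : ∀ x y, P x → P y → P (x + y)) : P v := by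
  have hv : v ∈ ⨆ n, A.wt n := by rw [A.internal.submodule_iSup_eq_top]; trivial
  refine Submodule.iSup_induction A.wt (motive := P) hv ?_ (hm 0 0 (Submodule.zero_mem _)) hadd
  intro k u hu
  rcases lt_or_ge k 0 with hk | hk
  · rw [hneg k hk] at hu
    rw [(Submodule.mem_bot ℂ).1 hu]
    exact hm 0 0 (Submodule.zero_mem _)
  · obtain ⟨n, rfl⟩ := Int.eq_ofNat_of_zero_le hk
    exact hm n u hu

theorem L_wt {k : ℤ} {u : V} (hu : u ∈ A.wt k) : A.Y A.omega 0 u ∈ A.wt (k + 1) := by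
  have := A.mode_wt 2 A.omega A.omega_wt k 0 u hu
  have e : k + 2 - 0 - 1 = k + 1 := by ring
  rwa [e] at this

theorem RR_L (k : ℕ) (q : ℤ) (u : V) :
    RR A (k + 1) q (A.Y A.omega 0 u)
      = (-(q : ℂ)) • RR A (k + 1) (q - 1) u - ((k : ℂ) + 1) • RR A k q u := by
  ext v
  simp only [LinearMap.sub_apply, LinearMap.smul_apply, RR_apply, A.translation]
  have h1 : ∀ i : ℕ, ((k + 1).choose i : ℂ) • (-(((i : ℤ) + q : ℤ) : ℂ)) • A.Y u ((i : ℤ) + q - 1) v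
      = (-(q : ℂ)) • (((k + 1).choose i : ℂ) • A.Y u ((i : ℤ) + (q - 1)) v)
        - ((i : ℂ) * ((k + 1).choose i : ℂ)) • A.Y u ((i : ℤ) + (q - 1)) v := by
    intro i
    have : (i : ℤ) + q - 1 = i + (q - 1) := by ring
    rw [this]
    push_cast
    module
  simp only [h1, Finset.sum_sub_distrib, ← Finset.smul_sum]
  congr 1
  rw [Finset.sum_range_succ', Finset.smul_sum]
  simp only [Nat.cast_zero, zero_mul, zero_smul, add_zero]
  refine Finset.sum_congr rfl fun i _ => ?_
  have h2 : (((i + 1 : ℕ) : ℂ) * ((k + 1).choose (i + 1) : ℂ)) = ((k : ℂ) + 1) * (k.choose i : ℂ) := by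
    have := Nat.add_one_mul_choose_eq k i
    have h3 : (((k + 1) * k.choose i : ℕ) : ℂ) = (((k + 1).choose (i + 1) * (i + 1) : ℕ) : ℂ) := by
      rw [this]
    push_cast at h3 ⊢
    linear_combination -h3
  have h4 : ((i + 1 : ℕ) : ℤ) + (q - 1) = i + q := by push_cast; ring
  rw [h2, h4, mul_smul]

theorem mem2 (m : ℕ) : ∀ {k : ℕ} {u : V} (v : V), u ∈ A.wt k →
    RR A k (-2 - m) u v ∈ A.Osub := by
  induction m with
  | zero =>
    intro k u v hu
    apply Submodule.subset_span
    exact ⟨k, u, v, hu, by rw [circAux_eq]; simp⟩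
  | succ m ih =>
    intro k u v hu
    have h1 := ih (k := k + 1) (u := A.Y A.omega 0 u) v (by exact_mod_cast L_wt A hu)
    have h2 := ih (k := k) (u := u) v hu
    rw [RR_L, RR_pascal] at h1
    simp only [LinearMap.sub_apply, LinearMap.smul_apply, LinearMap.add_apply] at h1
    have e1 : (-2 - (m : ℤ) - 1) = -2 - ((m + 1 : ℕ) : ℤ) := by push_cast; ring
    have e2 : -2 - ((m + 1 : ℕ) : ℤ) + 1 = -2 - (m : ℤ) := by push_cast; ring
    rw [e1, e2] at h1
    have hne : ((m : ℂ) + 2) ≠ 0 := by exact_mod_cast Nat.succ_ne_zero (m + 1)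
    have h3 : ((m : ℂ) + 2) • RR A k (-2 - ((m + 1 : ℕ) : ℤ)) u v ∈ A.Osub := by
      have := A.Osub.sub_mem h1 (A.Osub.smul_mem ((m : ℂ) + 1 - k) h2)
      convert this using 1
      push_cast
      module
    exact (Submodule.smul_mem_iff _ hne).1 h3

theorem mem3 (n : ℕ) : ∀ (m : ℕ) {k : ℕ} {u : V} (v : V), n ≤ m → u ∈ A.wt k →
    RR A (k + n) (-2 - m) u v ∈ A.Osub := by
  induction n with
  | zero => intro m k u v _ hu; exact mem2 A m v hu
  | succ n ih =>
    intro m k u v hm hu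
    obtain ⟨m, rfl⟩ : ∃ m', m = m' + 1 := ⟨m - 1, by omega⟩
    rw [← add_assoc, RR_pascal]
    refine A.Osub.add_mem (ih (m + 1) v (by omega) hu) ?_
    have := ih m v (by omega) hu
    convert this using 3
    push_cast; ring

theorem star_LL (u v w : V) (k : ℕ) : ∀ (l : ℕ) (p : ℤ),
    (∀ i : ℕ, A.Y u (p + i) v ∈ A.wt ((l : ℤ) + k - i)) →
    StarL A (RR A k p u v) w = LL A u v w k l p (-1) ∧ LL A u v w k l p (-2) ∈ A.Osub := by
  induction k with
  | zero =>
    intro l p h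
    have := h 0
    simp only [Nat.cast_zero, add_zero, sub_zero] at this
    rw [RR_zero, StarL_mem A this]
    refine ⟨rfl, ?_⟩
    have := mem2 A 0 w this
    simpa [LL] using this
  | succ k ih =>
    intro l p h
    obtain ⟨a1, a2⟩ := ih (l + 1) p (fun i => by
      have := h i; convert this using 2; push_cast; ring)
    obtain ⟨b1, b2⟩ := ih l (p + 1) (fun i => by
      have := h (i + 1); push_cast at this
      have e1 : p + 1 + (i : ℤ) = p + (i + 1) := by ring
      have e2 : (l : ℤ) + k - i = l + (k + 1) - (i + 1) := by ring
      rw [e1, e2]; exact this)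
    constructor
    · rw [RR_pascal, LinearMap.add_apply, LinearMap.add_apply, map_add, LinearMap.add_apply, a1, b1]
      rfl
    · exact A.Osub.add_mem a2 b2

theorem O_ind {P : V → Prop} (hneg : ∀ k : ℤ, k < 0 → A.wt k = ⊥) (x : V) (hx : x ∈ A.Osub)
    (h0 : P 0) (hadd : ∀ x y, P x → P y → P (x + y)) (hs : ∀ (c : ℂ) x, P x → P (c • x))
    (hg : ∀ (k l : ℕ) (u v : V), u ∈ A.wt k → v ∈ A.wt l → P (RR A k (-2) u v)) : P x := by
  unfold VOA.Osub at hx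
  induction hx using Submodule.span_induction with
  | mem x h =>
    obtain ⟨k, u, v, hu, rfl⟩ := h
    rcases lt_or_ge k 0 with hk | hk
    · rw [hneg k hk] at hu
      rw [(Submodule.mem_bot ℂ).1 hu]
      have : A.circAux k 0 v = 0 := by unfold VOA.circAux; simp
      rw [this]; exact h0
    · obtain ⟨n, rfl⟩ := Int.eq_ofNat_of_zero_le hk
      rw [circAux_eq]
      induction v using hom_ind A hneg with
      | hm l v hv => exact hg n l u v hu hv
      | hadd x y hx hy => rw [map_add]; exact hadd _ _ hx hy
  | zero => exact h0
  | add x y _ _ hx hy => exact hadd _ _ hx hy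
  | smul c x _ hx => exact hs _ _ hx

theorem right_ideal (hneg : ∀ k : ℤ, k < 0 → A.wt k = ⊥) (x w : V) (hx : x ∈ A.Osub) :
    StarL A x w ∈ A.Osub := by
  refine O_ind A (P := fun x => StarL A x w ∈ A.Osub) hneg x hx ?_ ?_ ?_ ?_
  · simp
  · intro x y hx hy; rw [map_add]; exact A.Osub.add_mem hx hy
  · intro c x hx; rw [map_smul]; exact A.Osub.smul_mem c hx
  · intro k l u v hu hv
    rw [(star_LL A u v w k (l + 1) (-2) (fun i => by
      have := A.mode_wt k u hu l (-2 + i) v hv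
      convert this using 2; push_cast; ring)).1]
    obtain ⟨N, hN⟩ := ident A u v w k (l + 1) (-2) (-1)
    rw [hN N le_rfl]
    refine A.Osub.sum_mem fun j _ => A.Osub.smul_mem _ (A.Osub.sub_mem ?_ (A.Osub.smul_mem _ ?_))
    · exact mem2 A j _ hu
    · have := mem3 A 1 (j + 1) (RR A k j u w) (by omega) hv
      convert this using 3
      push_cast; ring

theorem assoc (hneg : ∀ k : ℤ, k < 0 → A.wt k = ⊥) (u v w : V) :
    StarL A (StarL A u v) w - StarL A u (StarL A v w) ∈ A.Osub := by
  induction u using hom_ind A hneg with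
  | hadd x y hx hy =>
    have := A.Osub.add_mem hx hy
    convert this using 1
    simp only [map_add, LinearMap.add_apply]; abel
  | hm k u hu =>
  induction v using hom_ind A hneg with
  | hadd x y hx hy =>
    have := A.Osub.add_mem hx hy
    convert this using 1
    simp only [map_add, LinearMap.add_apply]; abel
  | hm l v hv =>
    rw [StarL_mem A hu, StarL_mem A hv]
    rw [(star_LL A u v w k l (-1) (fun i => by
      have := A.mode_wt k u hu l (-1 + i) v hv
      convert this using 2; push_cast; ring)).1]
    obtain ⟨N, hN⟩ := ident A u v w k l (-1) (-1)
    rw [hN (N + 1) (by omega), Finset.sum_range_succ']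
    have : ∀ x y z : V, x ∈ A.Osub → z ∈ A.Osub → x + (y - z) - y ∈ A.Osub := by
      intro x y z hx hz
      have := A.Osub.sub_mem hx hz
      convert this using 1
      abel
    simp only [pow_zero, zchoose_zero, mul_one, one_smul, Nat.cast_zero, sub_zero, add_zero]
    apply this
    · refine A.Osub.sum_mem fun j _ => A.Osub.smul_mem _ (A.Osub.sub_mem ?_ (A.Osub.smul_mem _ ?_))
      · have := mem2 A j (RR A l (-1 + ((j + 1 : ℕ) : ℤ)) v w) hu
        convert this using 3
        push_cast; ring
      · have := mem2 A (j + 1) (RR A k ((j + 1 : ℕ) : ℤ) u w) hv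
        convert this using 3
        push_cast; ring
    · apply A.Osub.smul_mem
      exact mem2 A 0 _ hv

theorem RR_one_ge (k : ℕ) : ∀ (q : ℤ) (x : V), 0 ≤ q → RR A k q x A.one = 0 := by
  intro q x hq
  rw [RR_apply]
  refine Finset.sum_eq_zero fun i _ => ?_
  rw [A.create_ge _ _ (by omega), smul_zero]

theorem RR_one_m1 (k : ℕ) (x : V) : RR A k (-1) x A.one = x := by
  induction k with
  | zero => rw [RR_zero, A.create]
  | succ k ih =>
    rw [RR_pascal, LinearMap.add_apply, LinearMap.add_apply, ih, RR_one_ge A k _ x (by norm_num),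
      add_zero]

theorem RR_one_m2 (k : ℕ) (x : V) : RR A k (-2) x A.one = A.Y x (-2) A.one + (k : ℂ) • x := by
  induction k with
  | zero => rw [RR_zero]; simp
  | succ k ih =>
    have e : (-2 : ℤ) + 1 = -1 := by norm_num
    rw [RR_pascal, LinearMap.add_apply, LinearMap.add_apply, ih, e, RR_one_m1]
    push_cast
    module

theorem L_one (x : V) : A.Y x (-2) A.one = A.Y A.omega 0 x := by
  have := A.create (A.Y A.omega 0 x)
  rw [A.translation] at this
  simpa using this

theorem tr_mem {k : ℕ} {x : V} (hx : x ∈ A.wt k) : A.Y A.omega 0 x + (k : ℂ) • x ∈ A.Osub := by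
  have := mem2 A 0 A.one hx
  simp only [Nat.cast_zero, sub_zero, RR_one_m2, L_one] at this
  exact this

theorem xm1 (i : ℕ) : ∀ {k : ℕ} {x : V}, x ∈ A.wt k →
    A.Y x (-1 - i) A.one - zchoose (-(k : ℤ)) i • x ∈ A.Osub := by
  induction i with
  | zero => intro k x hx; simp [A.create]
  | succ i ih =>
    intro k x hx
    have h1 := ih (k := k + 1) (x := A.Y A.omega 0 x) (by exact_mod_cast L_wt A hx)
    have h2 := tr_mem A hx
    rw [A.translation] at h1
    have hne : ((i : ℂ) + 1) ≠ 0 := by exact_mod_cast Nat.succ_ne_zero i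
    refine (Submodule.smul_mem_iff _ hne).1 ?_
    have e : -1 - ((i + 1 : ℕ) : ℤ) = -1 - (i : ℤ) - 1 := by push_cast; ring
    have e2 : -(((k + 1 : ℕ)) : ℤ) = -(k : ℤ) - 1 := by push_cast; ring
    rw [e]
    rw [e2] at h1
    have c1 := zchoose_succ (-(k : ℤ)) i
    have c2 := zchoose_shift i (-(k : ℤ) - 1)
    have e3 : -(k : ℤ) - 1 + 1 = -(k : ℤ) := by ring
    rw [e3] at c2
    push_cast at c1 c2
    have c3 : zchoose (-(k : ℤ)) (i + 1) * ((i : ℂ) + 1) = zchoose (-(k : ℤ) - 1) i * (-(k : ℂ)) := by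
      linear_combination c1 - c2
    have := A.Osub.add_mem h1 (A.Osub.smul_mem (zchoose (-(k : ℤ) - 1) i) h2)
    convert this using 1
    rw [smul_sub, smul_smul ((i : ℂ) + 1), mul_comm ((i : ℂ) + 1), c3, LinearMap.smul_apply]
    push_cast
    module

theorem zchoose_m1 (i : ℕ) : zchoose (-1) i = (-1) ^ i := by
  have := zchoose_neg 1 i
  have e : (1 : ℤ) + i - 1 = i := by ring
  rw [e, zchoose_nat] at this
  simpa using this

theorem skew (u v : V) (p : ℤ) (M : ℕ) (hM : ∀ q : ℤ, p + M ≤ q → A.Y u q v = 0) :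
    A.Y v p u = ((-1 : ℂ) ^ (p + 1)) •
      ∑ i ∈ range M, ((-1 : ℂ) ^ i) • A.Y (A.Y u (p + i) v) (-1 - i) A.one := by
  have hb := A.borcherds u v A.one p (-1) 0
  rw [finsum_eq_single (fun i : ℕ => ((-1 : ℂ) ^ i * zchoose p i) •
          (A.Y u (-1 + p - i) (A.Y v (0 + i) A.one)
            - ((-1 : ℂ) ^ p) • A.Y v (0 + p - i) (A.Y u (-1 + i) A.one))) 0 (fun i hi => by
      beta_reduce
      rw [A.create_ge v _ (by omega), A.create_ge u _ (by omega)]; simp)] at hb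
  simp only [pow_zero, zchoose_zero, mul_one, one_smul, Nat.cast_zero, sub_zero, add_zero,
    zero_add] at hb
  rw [A.create_ge v 0 le_rfl, A.create, map_zero, zero_sub] at hb
  have e : ∑ᶠ i : ℕ, zchoose (-1) i • A.Y (A.Y u (p + i) v) (-1 - i) A.one
      = ∑ i ∈ range M, ((-1 : ℂ) ^ i) • A.Y (A.Y u (p + i) v) (-1 - i) A.one := by
    simp only [zchoose_m1]
    apply finsum_eq_sum_of_support_subset
    intro j hj
    by_contra hj'
    apply hj
    have : M ≤ j := by simpa using hj'
    beta_reduce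
    rw [hM _ (by omega)]
    simp
  rw [e] at hb
  rw [hb, zpow_add_one₀ (by norm_num), smul_neg, smul_smul]
  have : ((-1 : ℂ) ^ p * -1 * (-1) ^ p) = -1 := by
    rcases Int.even_or_odd p with h | h
    · rw [h.neg_one_zpow]; norm_num
    · rw [h.neg_one_zpow]; norm_num
  rw [this]
  simp

theorem RR_ext (k N : ℕ) (q : ℤ) (u v : V) (hN : k < N) :
    RR A k q u v = ∑ i ∈ range N, (k.choose i : ℂ) • A.Y u ((i : ℤ) + q) v := by
  rw [RR_apply]
  apply Finset.sum_subset
  · intro i; simp only [mem_range]; omega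
  · intro i _ hi
    have : k < i := by simp only [mem_range] at hi; omega
    simp [Nat.choose_eq_zero_of_lt this]

theorem comm (hneg : ∀ k : ℤ, k < 0 → A.wt k = ⊥) {k : ℕ} {u : V} (v : V)
    (hu : u ∈ A.wt ((k + 1 : ℕ) : ℤ)) :
    StarL A u v - StarL A v u - RR A k 0 u v ∈ A.Osub := by
  induction v using hom_ind A hneg with
  | hadd x y hx hy =>
    have := A.Osub.add_mem hx hy
    convert this using 1
    simp only [map_add, LinearMap.add_apply]; abel
  | hm l v hv =>
    have h1 : StarL A u v = RR A k (-1) u v + RR A k 0 u v := by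
      rw [StarL_mem A hu, RR_pascal]; simp
    have goal2 : RR A k (-1) u v - StarL A v u ∈ A.Osub := by
      obtain ⟨N0, hN0⟩ := A.trunc u v
      obtain ⟨N, hNl, hNk, hN⟩ : ∃ N : ℕ, l < N ∧ k < N ∧ N0 + 1 ≤ N :=
        ⟨l + k + (N0 + 1).toNat + 1, by omega, by omega, by omega⟩
      rw [StarL_mem A hv, RR_ext A l N _ _ _ hNl, RR_ext A k N _ _ _ hNk]
      have hx : ∀ (i n : ℕ),
          A.Y (A.Y u ((n : ℤ) + -1) v) (-1 - i) A.one
            - zchoose ((n : ℤ) - (l + k + 1)) i • A.Y u ((n : ℤ) + -1) v ∈ A.Osub := by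
        intro i n
        have hw := A.mode_wt _ u hu l ((n : ℤ) + -1) v hv
        rcases lt_or_ge ((l : ℤ) + k + 1 - n) 0 with hk | hk
        · have hz : A.Y u ((n : ℤ) + -1) v = 0 := by
            rw [hneg _ (by push_cast; omega)] at hw
            simpa using hw
          rw [hz]; simp
        · obtain ⟨K, hK⟩ := Int.eq_ofNat_of_zero_le hk
          have hw' : A.Y u ((n : ℤ) + -1) v ∈ A.wt (K : ℤ) := by
            convert hw using 2; push_cast; omega
          have := xm1 A i hw'
          have e : ((n : ℤ) - (l + k + 1)) = -(K : ℤ) := by omega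
          rw [e]; exact this
      have h2 : ∀ j ∈ range N, (l.choose j : ℂ) • A.Y v ((j : ℤ) + -1) u
          = ∑ i ∈ range (N - j), ((-1 : ℂ) ^ (j + i) * (l.choose j : ℂ)) •
              A.Y (A.Y u (((j + i : ℕ) : ℤ) + -1) v) (-1 - i) A.one := by
        intro j hj
        rw [mem_range] at hj
        rw [skew A u v ((j : ℤ) + -1) (N - j) (fun q hq => hN0 q (by omega))]
        have e : ((j : ℤ) + -1 + 1) = j := by ring
        rw [e, zpow_natCast, smul_smul, Finset.smul_sum]
        refine Finset.sum_congr rfl fun i _ => ?_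
        rw [smul_smul]
        have e2 : (j : ℤ) + -1 + i = ((j + i : ℕ) : ℤ) + -1 := by push_cast; ring
        rw [e2, pow_add]
        congr 1; ring
      rw [Finset.sum_congr rfl h2]
      rw [← Finset.sum_range_diag_flip N (fun j i => ((-1 : ℂ) ^ (j + i) * (l.choose j : ℂ)) •
              A.Y (A.Y u (((j + i : ℕ) : ℤ) + -1) v) (-1 - i) A.one)]
      rw [← Finset.sum_sub_distrib]
      refine A.Osub.sum_mem fun n _ => ?_
      have h3 : (k.choose n : ℂ) = ∑ j ∈ range (n + 1), ((-1 : ℂ) ^ (j + (n - j)) * (l.choose j : ℂ))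
          * zchoose ((n : ℤ) - (l + k + 1)) (n - j) := by
        have := vander l ((n : ℤ) - (l + k + 1)) n
        rw [Finset.Nat.sum_antidiagonal_eq_sum_range_succ
          (fun a b => (l.choose a : ℂ) * zchoose ((n : ℤ) - (l + k + 1)) b)] at this
        have e : (n : ℤ) - (l + k + 1) + l = -(k + 1 - n) := by ring
        rw [e, zchoose_neg] at this
        have e2 : (k : ℤ) + 1 - n + n - 1 = k := by ring
        rw [e2, zchoose_nat] at this
        have e3 : (k.choose n : ℂ) = (-1) ^ n * ((-1) ^ n * (k.choose n : ℂ)) := by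
          rw [← mul_assoc, ← mul_pow]; simp
        rw [e3, ← this, Finset.mul_sum]
        refine Finset.sum_congr rfl fun j hj => ?_
        rw [mem_range] at hj
        rw [show j + (n - j) = n by omega]
        ring
      rw [h3, Finset.sum_smul, ← Finset.sum_sub_distrib]
      refine A.Osub.sum_mem fun j hj => ?_
      rw [mem_range] at hj
      have e4 : j + (n - j) = n := by omega
      have := A.Osub.smul_mem (-((-1 : ℂ) ^ n * (l.choose j : ℂ))) (hx (n - j) n)
      rw [e4]
      convert this using 1
      module
    rw [h1]
    convert goal2 using 1
    abel

theorem left_ideal (hneg : ∀ k : ℤ, k < 0 → A.wt k = ⊥)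
    (h0 : ∀ u ∈ A.wt 0, ∃ c : ℂ, u = c • A.one) (u x : V) (hx : x ∈ A.Osub) :
    StarL A u x ∈ A.Osub := by
  induction u using hom_ind A hneg with
  | hadd a b ha hb => rw [map_add, LinearMap.add_apply]; exact A.Osub.add_mem ha hb
  | hm k u hu =>
    cases k with
    | zero =>
      obtain ⟨c, rfl⟩ := h0 u (by simpa using hu)
      rw [map_smul, StarL_mem A (k := 0) (by simpa using A.one_wt), RR_zero, A.vacuum_act]
      simpa using A.Osub.smul_mem c hx
    | succ k =>
      have h1 : RR A k 0 u x ∈ A.Osub := by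
        refine O_ind A (P := fun x => RR A k 0 u x ∈ A.Osub) hneg x hx ?_ ?_ ?_ ?_
        · simp
        · intro x y hx hy; rw [map_add]; exact A.Osub.add_mem hx hy
        · intro c x hx; rw [map_smul]; exact A.Osub.smul_mem c hx
        · intro l r v w hv hw
          have h2 := (star_LL A u v w k l 0 (fun i => by
            have := A.mode_wt _ u hu l (0 + i) v hv
            convert this using 2; push_cast; ring)).2
          obtain ⟨N, hN⟩ := ident A u v w k l 0 (-2)
          rw [hN (N + 1) (by omega), Finset.sum_range_succ', Finset.sum_eq_zero (fun j _ => by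
            rw [zchoose_zero_left _ (Nat.succ_ne_zero j)]; simp)] at h2
          simp only [pow_zero, zchoose_zero, mul_one, one_smul, Nat.cast_zero, sub_zero, add_zero,
            zero_add, zpow_zero] at h2
          have h3 := mem2 A 0 (RR A k 0 u w) hv
          simp only [Nat.cast_zero, sub_zero] at h3
          have := A.Osub.add_mem h2 h3
          simpa using this
      have h2 := comm A hneg x hu
      have h3 := right_ideal A hneg x u hx
      have := A.Osub.add_mem (A.Osub.add_mem h2 h3) h1
      convert this using 1
      abel

/-- The product on the quotient. -/
noncomputable def mulQ (hneg : ∀ k : ℤ, k < 0 → A.wt k = ⊥)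
    (h0 : ∀ u ∈ A.wt 0, ∃ c : ℂ, u = c • A.one) :
    (V ⧸ A.Osub) →ₗ[ℂ] (V ⧸ A.Osub) →ₗ[ℂ] (V ⧸ A.Osub) :=
  (A.Osub.liftQ ((A.Osub.liftQ ((LinearMap.compRight ℂ A.Osub.mkQ).comp (StarL A)) (by
    intro x hx
    rw [LinearMap.mem_ker]
    ext w
    simpa using right_ideal A hneg x w hx)).flip) (by
    intro x hx
    rw [LinearMap.mem_ker]
    ext w
    simpa using left_ideal A hneg h0 w x hx)).flip

theorem mulQ_mk (hneg : ∀ k : ℤ, k < 0 → A.wt k = ⊥)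
    (h0 : ∀ u ∈ A.wt 0, ∃ c : ℂ, u = c • A.one) (u v : V) :
    mulQ A hneg h0 (A.Osub.mkQ u) (A.Osub.mkQ v) = A.Osub.mkQ (StarL A u v) := by
  simp [mulQ]

theorem exists_zhu (hneg : ∀ k : ℤ, k < 0 → A.wt k = ⊥)
    (h0 : ∀ u ∈ A.wt 0, ∃ c : ℂ, u = c • A.one) :
    ∃ (R : Type) (_ : Ring R) (_ : Algebra ℂ R), Nonempty (ZhuRealization A R) := by
  have hsurj : ∀ x : V ⧸ A.Osub, ∃ u, A.Osub.mkQ u = x := A.Osub.mkQ_surjective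
  have hone : ∀ u : V, StarL A A.one u = u := by
    intro u
    rw [StarL_mem A (k := 0) (by simpa using A.one_wt), RR_zero, A.vacuum_act]
    simp
  have hone2 : ∀ u : V, StarL A u A.one = u := by
    intro u
    induction u using hom_ind A hneg with
    | hadd x y hx hy => rw [map_add, LinearMap.add_apply, hx, hy]
    | hm k u hu => rw [StarL_mem A hu, RR_one_m1]
  let m := mulQ A hneg h0
  letI inst : Ring (V ⧸ A.Osub) :=
    { (inferInstance : AddCommGroup (V ⧸ A.Osub)) with
      mul := fun x y => m x y
      one := A.Osub.mkQ A.one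
      left_distrib := fun a b c => (m a).map_add b c
      right_distrib := fun a b c => by
        change m (a + b) c = m a c + m b c
        rw [map_add]; rfl
      zero_mul := fun a => by change m 0 a = 0; rw [map_zero]; rfl
      mul_zero := fun a => (m a).map_zero
      mul_assoc := fun a b c => by
        obtain ⟨u, rfl⟩ := hsurj a
        obtain ⟨v, rfl⟩ := hsurj b
        obtain ⟨w, rfl⟩ := hsurj c
        change m (m _ _) _ = m _ (m _ _)
        simp only [m, mulQ_mk]
        rw [← sub_eq_zero, ← map_sub]
        exact (Submodule.Quotient.mk_eq_zero _).2 (assoc A hneg u v w)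
      one_mul := fun a => by
        obtain ⟨u, rfl⟩ := hsurj a
        change m (A.Osub.mkQ A.one) _ = _
        simp only [m, mulQ_mk, hone]
      mul_one := fun a => by
        obtain ⟨u, rfl⟩ := hsurj a
        change m _ (A.Osub.mkQ A.one) = _
        simp only [m, mulQ_mk, hone2] }
  letI : Algebra ℂ (V ⧸ A.Osub) := Algebra.ofModule
    (fun r x y => by change m (r • x) y = r • m x y; rw [map_smul]; rfl)
    (fun r x y => by change m x (r • y) = r • m x y; rw [map_smul])
  refine ⟨V ⧸ A.Osub, inst, inferInstance, ⟨⟨A.Osub.mkQ, A.Osub.mkQ_surjective, A.Osub.ker_mkQ,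
    fun u v => ?_, rfl⟩⟩⟩
  rw [star_eq A hneg]
  exact (mulQ_mk A hneg h0 u v).symm

end
end Zhu


namespace Zhu
open Finset
set_option linter.unusedSimpArgs false

section
variable {V : Type} [AddCommGroup V] [Module ℂ V] {ℓ : ℕ} (A : VOA V) (hgen : Fin ℓ → V)

/-- Projection to a homogeneous component. -/
noncomputable def hc (k : ℤ) : V →ₗ[ℂ] V :=
  (A.wt k).subtype.comp ((DirectSum.component ℂ ℤ (fun n => A.wt n) k).comp
    A.decompose.toLinearMap)

theorem hc_same {k : ℤ} {v : V} (hv : v ∈ A.wt k) : hc A k v = v := by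
  unfold hc
  simp only [LinearMap.comp_apply, LinearEquiv.coe_coe]
  rw [decompose_of_mem A hv, DirectSum.component.lof_self]
  rfl

theorem hc_ne {k n : ℤ} {v : V} (hv : v ∈ A.wt n) (h : n ≠ k) : hc A k v = 0 := by
  unfold hc
  simp only [LinearMap.comp_apply, LinearEquiv.coe_coe]
  rw [decompose_of_mem A hv]
  rw [DirectSum.component.of, dif_neg h]
  simp

/-- The weight of a word. -/
def wwt : List (Fin ℓ × ℕ+) → ℤ
  | [] => 0
  | (_, n) :: L => ((n : ℕ) : ℤ) + wwt L

theorem wwt_nonneg (L : List (Fin ℓ × ℕ+)) : 0 ≤ wwt L := by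
  induction L with
  | nil => simp [wwt]
  | cons x L ih => obtain ⟨a, n⟩ := x; simp only [wwt]; have := n.pos; omega

theorem word_wt (H : IsHeisenberg A hgen) (L : List (Fin ℓ × ℕ+)) :
    wordAct (fun a k w => A.Y (hgen a) k w) L A.one ∈ A.wt (wwt L) := by
  induction L with
  | nil => exact A.one_wt
  | cons x L ih =>
    obtain ⟨a, n⟩ := x
    have := A.mode_wt 1 _ (H.wt_one a) _ (-((n : ℕ) : ℤ)) _ ih
    simp only [wordAct, wwt]
    convert this using 2
    ring

theorem wt_span (H : IsHeisenberg A hgen) {k : ℤ} {v : V} (hv : v ∈ A.wt k) :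
    v ∈ Submodule.span ℂ {v : V | ∃ L : List (Fin ℓ × ℕ+), wwt L = k ∧
        v = wordAct (fun a k w => A.Y (hgen a) k w) L A.one} := by
  have h1 : ∀ x : V, hc A k x ∈ Submodule.span ℂ {v : V | ∃ L : List (Fin ℓ × ℕ+), wwt L = k ∧
        v = wordAct (fun a k w => A.Y (hgen a) k w) L A.one} := by
    intro x
    have hx : x ∈ Submodule.span ℂ
      {v : V | ∃ L : List (Fin ℓ × ℕ+),
        v = wordAct (fun a k w => A.Y (hgen a) k w) L A.one} := by rw [H.span_words]; trivial
    induction hx using Submodule.span_induction with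
    | mem x h =>
      obtain ⟨L, rfl⟩ := h
      by_cases hL : wwt L = k
      · rw [hc_same A (hL ▸ word_wt A hgen H L)]
        exact Submodule.subset_span ⟨L, hL, rfl⟩
      · rw [hc_ne A (word_wt A hgen H L) hL]
        exact Submodule.zero_mem _
    | zero => rw [map_zero]; exact Submodule.zero_mem _
    | add x y _ _ hx hy => rw [map_add]; exact Submodule.add_mem _ hx hy
    | smul c x _ hx => rw [map_smul]; exact Submodule.smul_mem _ c hx
  have := h1 v
  rwa [hc_same A hv] at this

theorem heis_neg (H : IsHeisenberg A hgen) (k : ℤ) (hk : k < 0) : A.wt k = ⊥ := by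
  rw [eq_bot_iff]
  intro v hv
  have := wt_span A hgen H hv
  have e : {v : V | ∃ L : List (Fin ℓ × ℕ+), wwt L = k ∧
        v = wordAct (fun a k w => A.Y (hgen a) k w) L A.one} = ∅ := by
    ext x
    simp only [Set.mem_setOf_eq, Set.mem_empty_iff_false, iff_false]
    rintro ⟨L, hL, _⟩
    have := wwt_nonneg L
    omega
  rwa [e, Submodule.span_empty] at this

theorem heis_zero (H : IsHeisenberg A hgen) (v : V) (hv : v ∈ A.wt 0) : ∃ c : ℂ, v = c • A.one := by
  have := wt_span A hgen H hv
  have e : {v : V | ∃ L : List (Fin ℓ × ℕ+), wwt L = 0 ∧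
        v = wordAct (fun a k w => A.Y (hgen a) k w) L A.one} ⊆ {A.one} := by
    rintro x ⟨L, hL, rfl⟩
    cases L with
    | nil => rfl
    | cons x L =>
      obtain ⟨a, n⟩ := x
      have := wwt_nonneg L
      have h2 := n.pos
      simp only [wwt] at hL
      omega
  obtain ⟨c, hc⟩ := Submodule.mem_span_singleton.1 (Submodule.span_mono e this)
  exact ⟨c, hc.symm⟩

end

section
variable {V W : Type} [AddCommGroup V] [Module ℂ V] [AddCommGroup W] [Module ℂ W] {ℓ : ℕ}

theorem B_neg (S : HeisenbergPlusSetting ℓ V W) (k : ℤ) (hk : k < 0) : S.B.wt k = ⊥ := by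
  rw [eq_bot_iff]
  intro w hw
  have h1 := (S.fixedSub.map_wt k w).1 hw
  rw [heis_neg S.A S.hgen S.heis k hk, Submodule.mem_bot] at h1
  rw [Submodule.mem_bot]
  exact S.fixedSub.inj (by rw [h1, map_zero])

theorem B_zero (S : HeisenbergPlusSetting ℓ V W) (w : W) (hw : w ∈ S.B.wt 0) :
    ∃ c : ℂ, w = c • S.B.one := by
  obtain ⟨c, hc⟩ := heis_zero S.A S.hgen S.heis _ ((S.fixedSub.map_wt 0 w).1 hw)
  exact ⟨c, S.fixedSub.inj (by rw [hc, map_smul, S.fixedSub.map_one])⟩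

/-- The interface between the vertex operator algebra and its Zhu algebra. -/
structure Ctx (A : VOA V) (hgen : Fin ℓ → V) (R : Type) [Ring R] [Algebra ℂ R]
    (P : V →ₗ[ℂ] R) (F : Submodule ℂ V) : Prop where
  heis : IsHeisenberg A hgen
  one_mem : A.one ∈ F
  CC_mem : ∀ a b (m n : ℤ) v, v ∈ F → A.Y (hgen a) m (A.Y (hgen b) n v) ∈ F
  mul : ∀ (k : ℕ) u v, u ∈ A.wt k → u ∈ F → v ∈ F → P (RR A k (-1) u v) = P u * P v
  circ : ∀ (k m : ℕ) u v, u ∈ A.wt k → u ∈ F → v ∈ F → P (RR A k (-2 - m) u v) = 0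
  comm : ∀ (k : ℕ) u v, u ∈ A.wt ((k + 1 : ℕ) : ℤ) → u ∈ F → v ∈ F →
    P u * P v - P v * P u = P (RR A k 0 u v)
  tr : ∀ (k : ℕ) x, x ∈ A.wt k → x ∈ F → P (A.Y A.omega 0 x) + (k : ℂ) • P x = 0

theorem exists_ctx (S : HeisenbergPlusSetting ℓ V W) :
    ∃ (R : Type) (_ : Ring R) (_ : Algebra ℂ R) (Z : ZhuRealization S.B R) (P : V →ₗ[ℂ] R),
      (∀ w, P (S.ι w) = Z.π w) ∧ Ctx S.A S.hgen R P (LinearMap.range S.ι) := by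
  obtain ⟨R, i1, i2, ⟨Z⟩⟩ := exists_zhu S.B (B_neg S) (B_zero S)
  obtain ⟨g, hg⟩ := S.ι.exists_leftInverse_of_injective (LinearMap.ker_eq_bot.2 S.fixedSub.inj)
  have hP : ∀ w, (Z.π.comp g) (S.ι w) = Z.π w := by
    intro w
    have := LinearMap.congr_fun hg w
    simp only [LinearMap.comp_apply, LinearMap.id_apply] at this
    simp only [LinearMap.comp_apply, this]
  have hO : ∀ w, w ∈ S.B.Osub → Z.π w = 0 := by
    intro w hw; rw [← Z.ker_eq] at hw; exact hw
  have hRR : ∀ (k : ℕ) (q : ℤ) (u v : W), RR S.A k q (S.ι u) (S.ι v) = S.ι (RR S.B k q u v) := by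
    intro k q u v
    simp only [RR_apply, map_sum, map_smul, S.fixedSub.map_Y]
  have hstar : ∀ u v, Z.π (StarL S.B u v) = Z.π u * Z.π v := by
    intro u v; rw [← star_eq S.B (B_neg S), Z.map_star]
  have hF : ∀ v, v ∈ LinearMap.range S.ι ↔ S.θ v = v := by
    intro v
    rw [S.fixedSub.range_eq, Module.End.mem_eigenspace_iff]
    simp
  refine ⟨R, i1, i2, Z, Z.π.comp g, hP, ⟨S.heis, ⟨S.B.one, S.fixedSub.map_one⟩, ?_, ?_, ?_, ?_, ?_⟩⟩
  · intro a b m n v hv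
    rw [hF] at hv ⊢
    rw [S.thetaAut.map_Y, S.thetaAut.map_Y, S.thetaAut.map_gen, S.thetaAut.map_gen, hv]
    simp
  · rintro k _ _ hk ⟨u, rfl⟩ ⟨v, rfl⟩
    rw [hRR, hP, hP, hP, ← hstar, StarL_mem S.B ((S.fixedSub.map_wt k u).2 hk)]
  · rintro k m _ _ hk ⟨u, rfl⟩ ⟨v, rfl⟩
    rw [hRR, hP]
    exact hO _ (mem2 S.B m v ((S.fixedSub.map_wt k u).2 hk))
  · rintro k _ _ hk ⟨u, rfl⟩ ⟨v, rfl⟩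
    rw [hRR, hP, hP, hP, ← hstar, ← hstar, ← sub_eq_zero, ← map_sub, ← map_sub]
    exact hO _ (comm S.B (B_neg S) v ((S.fixedSub.map_wt _ u).2 hk))
  · rintro k _ hk ⟨u, rfl⟩
    rw [← S.fixedSub.map_omega, ← S.fixedSub.map_Y, hP, hP, ← map_smul, ← map_add]
    exact hO _ (tr_mem S.B ((S.fixedSub.map_wt k u).2 hk))

end
end Zhu


namespace Zhu
open Finset
set_option linter.unusedSimpArgs false

section
variable {V : Type} [AddCommGroup V] [Module ℂ V] {ℓ : ℕ}

/-- Creation operator `h_a(-n)`. -/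
noncomputable def C (A : VOA V) (hgen : Fin ℓ → V) (a : Fin ℓ) (n : ℕ) : Module.End ℂ V :=
  A.Y (hgen a) (-(n : ℤ))

/-- Modes of `h_a(-1)h_b(-1)1`. -/
noncomputable def U (A : VOA V) (hgen : Fin ℓ → V) (a b : Fin ℓ) (j : ℕ) : Module.End ℂ V :=
  A.Y (C A hgen a 1 (C A hgen b 1 A.one)) (1 - (j : ℤ))

variable {A : VOA V} {hgen : Fin ℓ → V}

theorem C_comm (H : IsHeisenberg A hgen) (a b : Fin ℓ) (n m : ℕ) (v : V) :
    C A hgen a n (C A hgen b m v) = C A hgen b m (C A hgen a n v) := by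
  have := LinearMap.congr_fun (H.heis_comm a b (-(n : ℤ)) (-(m : ℤ))) v
  simp only [LinearMap.sub_apply, Module.End.mul_apply, LinearMap.smul_apply,
    Module.End.one_apply] at this
  rw [← sub_eq_zero]
  unfold C
  rw [this]
  split_ifs with h
  · have : n = 0 := by omega
    subst this; simp
  · simp

theorem C_one (a : Fin ℓ) : C A hgen a 1 A.one = hgen a := by
  unfold C
  exact A.create _

theorem C_wt (H : IsHeisenberg A hgen) (a : Fin ℓ) (n k : ℕ) {v : V} (hv : v ∈ A.wt k) :
    C A hgen a n v ∈ A.wt ((n + k : ℕ) : ℤ) := by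
  have := A.mode_wt 1 _ (H.wt_one a) _ (-(n : ℤ)) _ hv
  unfold C
  convert this using 2
  push_cast; ring

theorem comm0 (u v w : V) (q : ℤ) :
    A.Y u 0 (A.Y v q w) = A.Y v q (A.Y u 0 w) + A.Y (A.Y u 0 v) q w := by
  have hb := A.borcherds u v w 0 0 q
  rw [finsum_eq_single _ 0 (fun i hi => by rw [zchoose_zero_left i hi, zero_smul]),
    finsum_eq_single _ 0 (fun i hi => by rw [zchoose_zero_left i hi, mul_zero, zero_smul])] at hb
  simp only [zchoose_zero, one_smul, Nat.cast_zero, add_zero, sub_zero, zero_add, pow_zero,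
    mul_one, zpow_zero] at hb
  rw [hb]; abel

theorem T_C (a : Fin ℓ) (n : ℕ) (v : V) :
    A.Y A.omega 0 (C A hgen a n v)
      = C A hgen a n (A.Y A.omega 0 v) + (n : ℂ) • C A hgen a (n + 1) v := by
  unfold C
  rw [comm0, A.translation]
  congr 1
  have : -((n + 1 : ℕ) : ℤ) = -(n : ℤ) - 1 := by push_cast; ring
  rw [this]
  simp

theorem T_one : A.Y A.omega 0 A.one = 0 := A.create_ge _ _ le_rfl

theorem annih (H : IsHeisenberg A hgen) (c a b : Fin ℓ) (i : ℕ) :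
    A.Y (hgen c) i (C A hgen a 1 (C A hgen b 1 A.one))
      = if i = 1 then (if c = a then hgen b else 0) + (if c = b then hgen a else 0) else 0 := by
  have h : ∀ (d : Fin ℓ) (v : V), A.Y (hgen c) i (C A hgen d 1 v) = C A hgen d 1 (A.Y (hgen c) i v)
      + (if c = d ∧ i = 1 then v else 0) := by
    intro d v
    have := LinearMap.congr_fun (H.heis_comm c d i (-((1 : ℕ) : ℤ))) v
    simp only [LinearMap.sub_apply, Module.End.mul_apply, LinearMap.smul_apply,
      Module.End.one_apply] at this
    unfold C
    rw [sub_eq_iff_eq_add] at this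
    rw [this, add_comm]
    congr 1
    by_cases hd : c = d
    · by_cases hi : i = 1
      · subst hi; simp [hd]
      · rw [if_neg (by rintro ⟨_, h⟩; omega), if_neg (by tauto)]; simp
    · simp [hd]
  rw [h, h, A.create_ge _ _ (by positivity)]
  rw [← C_one (A := A) (hgen := hgen) a, ← C_one (A := A) (hgen := hgen) b]
  by_cases hi : i = 1
  · by_cases h1 : c = a <;> by_cases h2 : c = b <;> simp_all [add_comm]
  · simp [hi]

theorem U_C (H : IsHeisenberg A hgen) (a b c : Fin ℓ) (j n : ℕ) (w : V) :
    U A hgen a b j (C A hgen c n w) = C A hgen c n (U A hgen a b j w)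
      + (n : ℂ) • ((if c = a then C A hgen b (n + j) w else 0)
        + (if c = b then C A hgen a (n + j) w else 0)) := by
  have hb := A.borcherds (hgen c) (C A hgen a 1 (C A hgen b 1 A.one)) w 0 (-(n : ℤ)) (1 - (j : ℤ))
  rw [finsum_eq_single _ 1 (fun i hi => by
      rw [zero_add, annih H, if_neg hi]; simp),
    finsum_eq_single _ 0 (fun i hi => by rw [zchoose_zero_left i hi, mul_zero, zero_smul])] at hb
  simp only [zchoose_zero, one_smul, Nat.cast_zero, add_zero, sub_zero, zero_add, pow_zero,
    mul_one, zpow_zero] at hb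
  have hz : zchoose (-(n : ℤ)) 1 = -(n : ℂ) := by
    have := zchoose_succ (-(n : ℤ)) 0
    simpa using this
  rw [annih H, if_pos rfl, hz] at hb
  have e : -(n : ℤ) + (1 - (j : ℤ)) - ((1 : ℕ) : ℤ) = -((n + j : ℕ) : ℤ) := by push_cast; ring
  rw [e] at hb
  unfold U

  unfold C at hb ⊢
  have hY : A.Y ((if c = a then hgen b else 0) + if c = b then hgen a else 0) (-((n + j : ℕ) : ℤ)) w
      = (if c = a then A.Y (hgen b) (-((n + j : ℕ) : ℤ)) w else 0)
        + (if c = b then A.Y (hgen a) (-((n + j : ℕ) : ℤ)) w else 0) := by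
    rw [map_add]
    split_ifs <;> simp
  rw [hY, neg_smul] at hb
  rw [← sub_eq_iff_eq_add', ← neg_sub, ← hb, neg_neg]

theorem U_one0 (a b : Fin ℓ) : U A hgen a b 0 A.one = 0 := A.create_ge _ _ (by norm_num)
theorem U_one1 (a b : Fin ℓ) : U A hgen a b 1 A.one = 0 := A.create_ge _ _ (by norm_num)
theorem U_one2 (a b : Fin ℓ) : U A hgen a b 2 A.one = C A hgen a 1 (C A hgen b 1 A.one) :=
  A.create _
theorem U_one3 (a b : Fin ℓ) : U A hgen a b 3 A.one
    = C A hgen a 1 (C A hgen b 2 A.one) + C A hgen a 2 (C A hgen b 1 A.one) := by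
  have := L_one A (C A hgen a 1 (C A hgen b 1 A.one))
  unfold U
  norm_num
  rw [this]
  simp [T_C, T_one]
theorem U_one4 (a b : Fin ℓ) : U A hgen a b 4 A.one
    = C A hgen a 1 (C A hgen b 3 A.one) + C A hgen a 2 (C A hgen b 2 A.one)
      + C A hgen a 3 (C A hgen b 1 A.one) := by
  have h1 := A.translation (C A hgen a 1 (C A hgen b 1 A.one)) (-2)
  have h2 := L_one A (A.Y A.omega 0 (C A hgen a 1 (C A hgen b 1 A.one)))
  rw [h1] at h2
  have e : (1 - ((4 : ℕ) : ℤ)) = -2 - 1 := by norm_num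
  unfold U
  rw [e]
  simp only [LinearMap.smul_apply, T_C, T_one, map_add, map_smul, map_zero, Nat.cast_one, one_smul,
    zero_add, Nat.cast_ofNat, Nat.reduceAdd] at h2
  push_cast at h2
  norm_num at h2
  norm_num
  have h3 : (2 : ℂ)⁻¹ • ((2 : ℂ) • A.Y (C A hgen a 1 (C A hgen b 1 A.one)) (-3) A.one)
     = A.Y (C A hgen a 1 (C A hgen b 1 A.one)) (-3) A.one := by
    rw [smul_smul]; norm_num
  rw [← h3, h2]
  module

end

section
variable {V : Type} [AddCommGroup V] [Module ℂ V] {ℓ : ℕ}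
variable {A : VOA V} {hgen : Fin ℓ → V} {R : Type} [Ring R] [Algebra ℂ R]
    {P : V →ₗ[ℂ] R} {F : Submodule ℂ V}

theorem Ctx.mem2 (X : Ctx A hgen R P F) (a b : Fin ℓ) (i j : ℕ) :
    C A hgen a i (C A hgen b j A.one) ∈ F := X.CC_mem _ _ _ _ _ X.one_mem

theorem Ctx.wt2 (X : Ctx A hgen R P F) (a b : Fin ℓ) (i j : ℕ) :
    C A hgen a i (C A hgen b j A.one) ∈ A.wt ((i + j : ℕ) : ℤ) := by
  have := C_wt X.heis a i _ (C_wt X.heis b j 0 (by simpa using A.one_wt))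
  simpa using this

theorem Ctx.ctr (X : Ctx A hgen R P F) (a b : Fin ℓ) (i j : ℕ) :
    (i : ℂ) • P (C A hgen a (i + 1) (C A hgen b j A.one))
      + (j : ℂ) • P (C A hgen a i (C A hgen b (j + 1) A.one))
      + ((i : ℂ) + j) • P (C A hgen a i (C A hgen b j A.one)) = 0 := by
  have := X.tr _ _ (X.wt2 a b i j) (X.mem2 a b i j)
  simp only [T_C, T_one, map_add, map_smul, map_zero, zero_add] at this
  push_cast at this
  rw [← this]
  abel

theorem RR2 (u v : V) (q : ℤ) : RR A 2 q u v
    = A.Y u q v + (2 : ℂ) • A.Y u (q + 1) v + A.Y u (q + 2) v := by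
  rw [RR_apply, Finset.sum_range_succ, Finset.sum_range_succ, Finset.sum_range_succ]
  simp [Nat.choose, add_comm q]

theorem RR1 (u v : V) (q : ℤ) : RR A 1 q u v
    = A.Y u q v + A.Y u (q + 1) v := by
  rw [RR_apply, Finset.sum_range_succ, Finset.sum_range_succ]
  simp [add_comm q]

theorem Ctx.cU (X : Ctx A hgen R P F) (x y : Fin ℓ) (m : ℕ) {v : V} (hv : v ∈ F) :
    P (U A hgen x y (m + 3) v) + (2 : ℂ) • P (U A hgen x y (m + 2) v)
      + P (U A hgen x y (m + 1) v) = 0 := by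
  have := X.circ 2 m _ v (by simpa using X.wt2 x y 1 1) (X.mem2 x y 1 1) hv
  rw [RR2] at this
  have e1 : (-2 - (m : ℤ)) = 1 - ((m + 3 : ℕ) : ℤ) := by push_cast; ring
  have e2 : (-2 - (m : ℤ) + 1) = 1 - ((m + 2 : ℕ) : ℤ) := by push_cast; ring
  have e3 : (-2 - (m : ℤ) + 2) = 1 - ((m + 1 : ℕ) : ℤ) := by push_cast; ring
  rw [e3, e2, e1, map_add, map_add, map_smul] at this
  exact this

theorem Ctx.mulU (X : Ctx A hgen R P F) (x y : Fin ℓ) {v : V} (hv : v ∈ F) :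
    P (C A hgen x 1 (C A hgen y 1 A.one)) * P v
      = P (U A hgen x y 2 v) + (2 : ℂ) • P (U A hgen x y 1 v) + P (U A hgen x y 0 v) := by
  have := X.mul 2 _ v (by simpa using X.wt2 x y 1 1) (X.mem2 x y 1 1) hv
  rw [RR2, map_add, map_add, map_smul] at this
  rw [← this]; rfl

theorem Ctx.commU (X : Ctx A hgen R P F) (x y : Fin ℓ) {v : V} (hv : v ∈ F) :
    P (C A hgen x 1 (C A hgen y 1 A.one)) * P v - P v * P (C A hgen x 1 (C A hgen y 1 A.one))
      = P (U A hgen x y 1 v) + P (U A hgen x y 0 v) := by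
  have := X.comm 1 _ v (by simpa using X.wt2 x y 1 1) (X.mem2 x y 1 1) hv
  rw [RR1, map_add] at this
  rw [this]; rfl

end
end Zhu

namespace Zhu
open Finset
set_option linter.unusedSimpArgs false
section
variable {V : Type} [AddCommGroup V] [Module ℂ V] {ℓ : ℕ}
variable {A : VOA V} {hgen : Fin ℓ → V} {R : Type} [Ring R] [Algebra ℂ R]
    {P : V →ₗ[ℂ] R} {F : Submodule ℂ V}

/-- Image of a two-letter word. -/
noncomputable def wd (A : VOA V) (hgen : Fin ℓ → V) (P : V →ₗ[ℂ] R) (a b : Fin ℓ) (i j : ℕ) : R :=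
  P (C A hgen a i (C A hgen b j A.one))

theorem wd_def (a b : Fin ℓ) (i j : ℕ) :
    P (C A hgen a i (C A hgen b j A.one)) = wd A hgen P a b i j := rfl

theorem Ctx.sw (X : Ctx A hgen R P F) (a b : Fin ℓ) (i j : ℕ) :
    wd A hgen P b a i j = wd A hgen P a b j i := by
  unfold wd
  rw [C_comm X.heis]

theorem Ctx.step (X : Ctx A hgen R P F) (a b : Fin ℓ) (i j : ℕ) :
    wd A hgen P a b (i + 2) j = (-(1 / ((i : ℂ) + 1))) • ((j : ℂ) • wd A hgen P a b (i + 1) (j + 1)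
      + ((i : ℂ) + 1 + j) • wd A hgen P a b (i + 1) j) := by
  have h := X.ctr a b (i + 1) j
  have hi : (i : ℂ) + 1 ≠ 0 := by exact_mod_cast Nat.succ_ne_zero i
  push_cast at h
  simp only [wd_def] at h
  have h' : ((i : ℂ) + 1) • wd A hgen P a b (i + 2) j
    = -((j : ℂ) • wd A hgen P a b (i + 1) (j + 1)
      + ((i : ℂ) + 1 + j) • wd A hgen P a b (i + 1) j) := by
    linear_combination (norm := module) h
  rw [neg_smul, ← smul_neg, ← h', smul_smul, one_div, inv_mul_cancel₀ hi, one_smul]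

theorem Ctx.w21 (X : Ctx A hgen R P F) (a b : Fin ℓ) : wd A hgen P a b 2 1
    = (-2 : ℂ) • wd A hgen P a b 1 1 + (-1 : ℂ) • wd A hgen P a b 1 2 := by
  have h := X.step a b 0 1
  norm_num [] at h
  rw [h]; module

theorem Ctx.w22 (X : Ctx A hgen R P F) (a b : Fin ℓ) : wd A hgen P a b 2 2
    = (-3 : ℂ) • wd A hgen P a b 1 2 + (-2 : ℂ) • wd A hgen P a b 1 3 := by
  have h := X.step a b 0 2
  norm_num [] at h
  rw [h]; module

theorem Ctx.w23 (X : Ctx A hgen R P F) (a b : Fin ℓ) : wd A hgen P a b 2 3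
    = (-4 : ℂ) • wd A hgen P a b 1 3 + (-3 : ℂ) • wd A hgen P a b 1 4 := by
  have h := X.step a b 0 3
  norm_num [] at h
  rw [h]; module

theorem Ctx.w24 (X : Ctx A hgen R P F) (a b : Fin ℓ) : wd A hgen P a b 2 4
    = (-5 : ℂ) • wd A hgen P a b 1 4 + (-4 : ℂ) • wd A hgen P a b 1 5 := by
  have h := X.step a b 0 4
  norm_num [] at h
  rw [h]; module

theorem Ctx.w25 (X : Ctx A hgen R P F) (a b : Fin ℓ) : wd A hgen P a b 2 5
    = (-6 : ℂ) • wd A hgen P a b 1 5 + (-5 : ℂ) • wd A hgen P a b 1 6 := by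
  have h := X.step a b 0 5
  norm_num [] at h
  rw [h]; module

theorem Ctx.w31 (X : Ctx A hgen R P F) (a b : Fin ℓ) : wd A hgen P a b 3 1
    = (3 : ℂ) • wd A hgen P a b 1 1 + (3 : ℂ) • wd A hgen P a b 1 2 + (1 : ℂ) • wd A hgen P a b 1 3 := by
  have h := X.step a b 1 1
  norm_num [X.w22 a b, X.w21 a b] at h
  rw [h]; module

theorem Ctx.w32 (X : Ctx A hgen R P F) (a b : Fin ℓ) : wd A hgen P a b 3 2
    = (6 : ℂ) • wd A hgen P a b 1 2 + (8 : ℂ) • wd A hgen P a b 1 3 + (3 : ℂ) • wd A hgen P a b 1 4 := by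
  have h := X.step a b 1 2
  norm_num [X.w23 a b, X.w22 a b] at h
  rw [h]; module

theorem Ctx.w33 (X : Ctx A hgen R P F) (a b : Fin ℓ) : wd A hgen P a b 3 3
    = (10 : ℂ) • wd A hgen P a b 1 3 + (15 : ℂ) • wd A hgen P a b 1 4 + (6 : ℂ) • wd A hgen P a b 1 5 := by
  have h := X.step a b 1 3
  norm_num [X.w24 a b, X.w23 a b] at h
  rw [h]; module

theorem Ctx.w41 (X : Ctx A hgen R P F) (a b : Fin ℓ) : wd A hgen P a b 4 1
    = (-4 : ℂ) • wd A hgen P a b 1 1 + (-6 : ℂ) • wd A hgen P a b 1 2 + (-4 : ℂ) • wd A hgen P a b 1 3 + (-1 : ℂ) • wd A hgen P a b 1 4 := by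
  have h := X.step a b 2 1
  norm_num [X.w32 a b, X.w31 a b] at h
  rw [h]; module

theorem Ctx.w42 (X : Ctx A hgen R P F) (a b : Fin ℓ) : wd A hgen P a b 4 2
    = (-10 : ℂ) • wd A hgen P a b 1 2 + (-20 : ℂ) • wd A hgen P a b 1 3 + (-15 : ℂ) • wd A hgen P a b 1 4 + (-4 : ℂ) • wd A hgen P a b 1 5 := by
  have h := X.step a b 2 2
  norm_num [X.w33 a b, X.w32 a b] at h
  rw [h]; module

theorem Ctx.w51 (X : Ctx A hgen R P F) (a b : Fin ℓ) : wd A hgen P a b 5 1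
    = (5 : ℂ) • wd A hgen P a b 1 1 + (10 : ℂ) • wd A hgen P a b 1 2 + (10 : ℂ) • wd A hgen P a b 1 3 + (5 : ℂ) • wd A hgen P a b 1 4 + (1 : ℂ) • wd A hgen P a b 1 5 := by
  have h := X.step a b 3 1
  norm_num [X.w42 a b, X.w41 a b] at h
  rw [h]; module

theorem Ctx.M1 (X : Ctx A hgen R P F) {a b : Fin ℓ} (hab : a ≠ b) :
    (-(45 / 2) : ℂ) • wd A hgen P a b 1 2 - (165 : ℂ) • wd A hgen P a b 1 3
      - (765 / 2 : ℂ) • wd A hgen P a b 1 4 - (360 : ℂ) • wd A hgen P a b 1 5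
      - (120 : ℂ) • wd A hgen P a b 1 6 = 0 := by
  have h0 := X.cU b b 0 (X.mem2 a b 2 2)
  have h1 := X.cU a b 0 (X.mem2 b b 1 2)
  have h2 := X.cU b b 0 (X.mem2 a b 1 1)
  have h3 := X.cU b b 0 (X.mem2 a b 1 2)
  have h4 := X.cU b b 1 (X.mem2 a b 2 1)
  have h5 := X.cU a b 0 (X.mem2 b b 1 1)
  have h6 := X.cU a b 0 (X.mem2 b b 1 3)
  have h7 := X.cU b b 0 (X.mem2 a b 1 3)
  have h8 := X.cU b b 1 (X.mem2 a b 1 1)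
  simp only [U_C X.heis, if_true, if_false, U_one0, U_one1, U_one2, U_one3, U_one4, map_add,
    map_smul, map_zero, add_zero, zero_add, smul_add, smul_zero, Nat.cast_one, Nat.cast_ofNat,
    Nat.reduceAdd, one_smul, smul_smul, hab, hab.symm, C_comm X.heis b a,
    C_comm X.heis b b 2 1, C_comm X.heis b b 3 1, C_comm X.heis b b 3 2, C_comm X.heis b b 4 1] at h0 h1 h2 h3 h4 h5 h6 h7 h8
  have t13 := X.ctr a b 1 3
  have t14 := X.ctr a b 1 4
  have t22 := X.ctr a b 2 2
  have t12 := X.ctr a b 1 2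
  have t31 := X.ctr a b 3 1
  have t32 := X.ctr a b 3 2
  have t23 := X.ctr a b 2 3
  have t41 := X.ctr a b 4 1
  have t21 := X.ctr a b 2 1
  have t33 := X.ctr a b 3 3
  have t24 := X.ctr a b 2 4
  have t15 := X.ctr a b 1 5
  have t51 := X.ctr a b 5 1
  have t42 := X.ctr a b 4 2
  simp only [Nat.cast_one, Nat.cast_ofNat, Nat.reduceAdd] at t13 t14 t22 t12 t31 t32 t23 t41 t21 t33 t24 t15 t51 t42
  unfold wd
  linear_combination (norm := module) (15/8 : ℂ) • h0
    + (45/4 : ℂ) • h1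
    + (-15/8 : ℂ) • h2
    + (-15/4 : ℂ) • h3
    + (-15/4 : ℂ) • h4
    + (15/4 : ℂ) • h5
    + (15/2 : ℂ) • h6
    + (-15/4 : ℂ) • h7
    + (-15/4 : ℂ) • h8
    + (-245/8 : ℂ) • t13
    + (-351/8 : ℂ) • t14
    + (-5/8 : ℂ) • t22
    + (-25/4 : ℂ) • t12
    + (-65/8 : ℂ) • t31
    + (-21/8 : ℂ) • t32
    + (39/8 : ℂ) • t23
    + (-81/8 : ℂ) • t41
    + (-5/2 : ℂ) • t21
    + (-13/4 : ℂ) • t33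
    + (39/8 : ℂ) • t24
    + (-39/2 : ℂ) • t15
    + (-9/2 : ℂ) • t51
    + (9/8 : ℂ) • t42

/-- The element `S_bb(1,3) - S_bb(1,1)`. -/
noncomputable def zz (A : VOA V) (hgen : Fin ℓ → V) (P : V →ₗ[ℂ] R) (b : Fin ℓ) : R :=
  wd A hgen P b b 1 3 - wd A hgen P b b 1 1

theorem Ctx.Z2 (X : Ctx A hgen R P F) {a b : Fin ℓ} (hab : a ≠ b) :
    wd A hgen P a b 1 1 * zz A hgen P b = (5 / 2 : ℂ) • wd A hgen P a b 1 2 + (13 : ℂ) • wd A hgen P a b 1 3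
      + (39 / 2 : ℂ) • wd A hgen P a b 1 4 + (9 : ℂ) • wd A hgen P a b 1 5 := by
  have h0 := X.cU b b 0 (X.mem2 a b 1 2)
  have h1 := X.cU b b 0 (X.mem2 a b 1 1)
  have h2 := X.cU b b 1 (X.mem2 a b 1 1)
  have k3 := X.mulU a b (X.mem2 b b 1 3)
  have k1 := X.mulU a b (X.mem2 b b 1 1)
  simp only [U_C X.heis, if_true, if_false, U_one0, U_one1, U_one2, U_one3, U_one4, map_add,
    map_smul, map_zero, add_zero, zero_add, smul_add, smul_zero, Nat.cast_one, Nat.cast_ofNat,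
    Nat.reduceAdd, one_smul, smul_smul, hab, hab.symm, C_comm X.heis b a,
    C_comm X.heis b b 2 1, C_comm X.heis b b 3 1, C_comm X.heis b b 3 2, C_comm X.heis b b 4 1] at h0 h1 h2 k3 k1
  have t11 := X.ctr a b 1 1
  have t21 := X.ctr a b 2 1
  have t13 := X.ctr a b 1 3
  have t31 := X.ctr a b 3 1
  have t22 := X.ctr a b 2 2
  have t23 := X.ctr a b 2 3
  have t14 := X.ctr a b 1 4
  have t41 := X.ctr a b 4 1
  have t32 := X.ctr a b 3 2
  simp only [Nat.cast_one, Nat.cast_ofNat, Nat.reduceAdd] at t11 t21 t13 t31 t22 t23 t14 t41 t32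
  unfold zz wd
  rw [mul_sub]
  linear_combination (norm := module) (-1/4 : ℂ) • h0
    + (-3/4 : ℂ) • h1
    + (1/2 : ℂ) • h2
    + (1 : ℂ) • k3
    + (-1 : ℂ) • k1
    + (-1 : ℂ) • t11
    + (-1 : ℂ) • t21
    + (-9/4 : ℂ) • t13
    + (3/4 : ℂ) • t31
    + (1/4 : ℂ) • t22
    + (3/4 : ℂ) • t23
    + (-9/4 : ℂ) • t14
    + (3/4 : ℂ) • t41
    + (-1/4 : ℂ) • t32

theorem Ctx.Z1 (X : Ctx A hgen R P F) {a b c : Fin ℓ} (hab : a ≠ b) (hac : a ≠ c) (hbc : b ≠ c) :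
    wd A hgen P a b 1 1 * zz A hgen P c = (1 / 2 : ℂ) • wd A hgen P a b 1 2 + (2 : ℂ) • wd A hgen P a b 1 3
      + (5 / 2 : ℂ) • wd A hgen P a b 1 4 + wd A hgen P a b 1 5 := by
  have h0 := X.cU a c 0 (X.mem2 b c 1 2)
  have h1 := X.cU c c 0 (X.mem2 a b 1 1)
  have h2 := X.cU c c 1 (X.mem2 a b 1 1)
  have h3 := X.cU a b 0 (X.mem2 c c 1 2)
  have h4 := X.cU c c 0 (X.mem2 a b 1 2)
  have h5 := X.cU a c 0 (X.mem2 b c 1 1)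
  have h6 := X.cU a b 0 (X.mem2 c c 1 1)
  have k3 := X.mulU a b (X.mem2 c c 1 3)
  have k1 := X.mulU a b (X.mem2 c c 1 1)
  simp only [U_C X.heis, if_true, if_false, U_one0, U_one1, U_one2, U_one3, U_one4, map_add,
    map_smul, map_zero, add_zero, zero_add, smul_add, smul_zero, Nat.cast_one, Nat.cast_ofNat,
    Nat.reduceAdd, one_smul, smul_smul, hab, hab.symm, hac, hac.symm, hbc, hbc.symm, C_comm X.heis b a, C_comm X.heis c a,
    C_comm X.heis c b, C_comm X.heis c c 2 1, C_comm X.heis c c 3 1, C_comm X.heis c c 3 2, C_comm X.heis c c 4 1] at h0 h1 h2 h3 h4 h5 h6 k3 k1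
  have t12 := X.ctr a b 1 2
  have t31 := X.ctr a b 3 1
  have t13 := X.ctr a b 1 3
  have t41 := X.ctr a b 4 1
  have t32 := X.ctr a b 3 2
  have t23 := X.ctr a b 2 3
  have t14 := X.ctr a b 1 4
  have t21 := X.ctr a b 2 1
  simp only [Nat.cast_one, Nat.cast_ofNat, Nat.reduceAdd] at t12 t31 t13 t41 t32 t23 t14 t21
  unfold zz wd
  rw [mul_sub]
  linear_combination (norm := module) (-1/2 : ℂ) • h0
    + (-3/4 : ℂ) • h1
    + (1/2 : ℂ) • h2
    + (1/2 : ℂ) • h3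
    + (-1/4 : ℂ) • h4
    + (-1/2 : ℂ) • h5
    + (1/2 : ℂ) • h6
    + (1 : ℂ) • k3
    + (-1 : ℂ) • k1
    + (-1/6 : ℂ) • t12
    + (5/12 : ℂ) • t31
    + (-5/12 : ℂ) • t13
    + (1/4 : ℂ) • t41
    + (-1/12 : ℂ) • t32
    + (1/12 : ℂ) • t23
    + (-1/4 : ℂ) • t14
    + (1/6 : ℂ) • t21

theorem Ctx.W (X : Ctx A hgen R P F) {a b c : Fin ℓ} (hab : a ≠ b) (hac : a ≠ c) (hbc : b ≠ c) :
    wd A hgen P c c 1 1 * (-wd A hgen P a b 1 1 - wd A hgen P a b 1 2) = wd A hgen P a b 1 2 + (2 : ℂ) • wd A hgen P a b 1 3 + wd A hgen P a b 1 4 := by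
  have h0 := X.cU a c 0 (X.mem2 b c 1 1)
  have h1 := X.cU a b 0 (X.mem2 c c 1 1)
  have h2 := X.cU c c 0 (X.mem2 a b 1 1)
  have k3 := X.mulU c c (X.mem2 a b 1 1)
  have k1 := X.mulU c c (X.mem2 a b 1 2)
  simp only [U_C X.heis, if_true, if_false, U_one0, U_one1, U_one2, U_one3, U_one4, map_add,
    map_smul, map_zero, add_zero, zero_add, smul_add, smul_zero, Nat.cast_one, Nat.cast_ofNat,
    Nat.reduceAdd, one_smul, smul_smul, hab, hab.symm, hac, hac.symm, hbc, hbc.symm, C_comm X.heis b a, C_comm X.heis c a,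
    C_comm X.heis c b, C_comm X.heis c c 2 1, C_comm X.heis c c 3 1, C_comm X.heis c c 3 2, C_comm X.heis c c 4 1] at h0 h1 h2 k3 k1
  have t21 := X.ctr a b 2 1
  have t12 := X.ctr a b 1 2
  have t31 := X.ctr a b 3 1
  have t22 := X.ctr a b 2 2
  have t13 := X.ctr a b 1 3
  simp only [Nat.cast_one, Nat.cast_ofNat, Nat.reduceAdd] at t21 t12 t31 t22 t13
  unfold wd
  rw [mul_sub, mul_neg]
  linear_combination (norm := module) (1 : ℂ) • h0
    + (-1 : ℂ) • h1
    + (-1/2 : ℂ) • h2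
    + (-1 : ℂ) • k3
    + (-1 : ℂ) • k1
    + (-1/3 : ℂ) • t21
    + (-1/3 : ℂ) • t12
    + (-1/3 : ℂ) • t31
    + (1/6 : ℂ) • t22
    + (-1/3 : ℂ) • t13

theorem Ctx.Z2c (X : Ctx A hgen R P F) {a b : Fin ℓ} (hab : a ≠ b) :
    wd A hgen P a b 1 1 * zz A hgen P b - zz A hgen P b * wd A hgen P a b 1 1
      = wd A hgen P a b 2 3 - (2 : ℂ) • wd A hgen P a b 2 1 + (3 : ℂ) • wd A hgen P a b 4 1
        + wd A hgen P a b 1 3 - (2 : ℂ) • wd A hgen P a b 1 1 + (3 : ℂ) • wd A hgen P a b 3 1 := by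
  have k3 := X.commU a b (X.mem2 b b 1 3)
  have k1 := X.commU a b (X.mem2 b b 1 1)
  simp only [U_C X.heis, if_true, if_false, U_one0, U_one1, U_one2, U_one3, U_one4, map_add,
    map_smul, map_zero, add_zero, zero_add, smul_add, smul_zero, Nat.cast_one, Nat.cast_ofNat,
    Nat.reduceAdd, one_smul, smul_smul, hab, hab.symm, C_comm X.heis b a,
    C_comm X.heis b b 2 1, C_comm X.heis b b 3 1, C_comm X.heis b b 3 2, C_comm X.heis b b 4 1] at k3 k1
  unfold zz wd
  rw [mul_sub, sub_mul]
  linear_combination (norm := module) (1 : ℂ) • k3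
    + (-1 : ℂ) • k1

theorem Ctx.Z1c (X : Ctx A hgen R P F) {a b c : Fin ℓ} (hab : a ≠ b) (hac : a ≠ c) (hbc : b ≠ c) :
    wd A hgen P a b 1 1 * zz A hgen P c = zz A hgen P c * wd A hgen P a b 1 1 := by
  have k3 := X.commU a b (X.mem2 c c 1 3)
  have k1 := X.commU a b (X.mem2 c c 1 1)
  simp only [U_C X.heis, if_true, if_false, U_one0, U_one1, U_one2, U_one3, U_one4, map_add,
    map_smul, map_zero, add_zero, zero_add, smul_add, smul_zero, Nat.cast_one, Nat.cast_ofNat,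
    Nat.reduceAdd, one_smul, smul_smul, hab, hab.symm, hac, hac.symm, hbc, hbc.symm, C_comm X.heis b a, C_comm X.heis c a,
    C_comm X.heis c b, C_comm X.heis c c 2 1, C_comm X.heis c c 3 1, C_comm X.heis c c 3 2, C_comm X.heis c c 4 1] at k3 k1
  unfold zz wd
  rw [mul_sub, sub_mul]
  linear_combination (norm := module) (1 : ℂ) • k3
    + (-1 : ℂ) • k1

theorem Ctx.ob (X : Ctx A hgen R P F) {a b : Fin ℓ} (hab : a ≠ b) (n : ℕ) :
    wd A hgen P b b 1 1 * wd A hgen P a b 1 n - wd A hgen P a b 1 n * wd A hgen P b b 1 1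
      = (2 * n : ℂ) • (wd A hgen P a b 1 (n + 1) + wd A hgen P a b 1 n) := by
  have k3 := X.commU b b (X.mem2 a b 1 n)
  simp only [U_C X.heis, if_true, if_false, U_one0, U_one1, U_one2, U_one3, U_one4, map_add,
    map_smul, map_zero, add_zero, zero_add, smul_add, smul_zero, Nat.cast_one, Nat.cast_ofNat,
    Nat.reduceAdd, one_smul, smul_smul, hab, hab.symm, C_comm X.heis b a,
    C_comm X.heis b b 2 1, C_comm X.heis b b 3 1, C_comm X.heis b b 3 2, C_comm X.heis b b 4 1] at k3
  unfold wd
  linear_combination (norm := module) (1 : ℂ) • k3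

theorem Ctx.oa (X : Ctx A hgen R P F) {a b : Fin ℓ} (hab : a ≠ b) (n : ℕ) :
    wd A hgen P a a 1 1 * wd A hgen P a b 1 n - wd A hgen P a b 1 n * wd A hgen P a a 1 1
      = -((2 * n : ℂ) • (wd A hgen P a b 1 (n + 1) + wd A hgen P a b 1 n)) := by
  have t := X.ctr a b 1 n
  simp only [Nat.cast_one, Nat.reduceAdd] at t
  have k3 := X.commU a a (X.mem2 a b 1 n)
  simp only [U_C X.heis, if_true, if_false, U_one0, U_one1, U_one2, U_one3, U_one4, map_add,
    map_smul, map_zero, add_zero, zero_add, smul_add, smul_zero, Nat.cast_one, Nat.cast_ofNat,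
    Nat.reduceAdd, one_smul, smul_smul, hab, hab.symm, C_comm X.heis b a,
    C_comm X.heis b b 2 1, C_comm X.heis b b 3 1, C_comm X.heis b b 3 2, C_comm X.heis b b 4 1] at k3
  unfold wd
  linear_combination (norm := module) (1 : ℂ) • k3
    + (2 : ℂ) • t

theorem Ctx.oc (X : Ctx A hgen R P F) {a b c : Fin ℓ} (hab : a ≠ b) (hac : a ≠ c) (hbc : b ≠ c) (n : ℕ) :
    wd A hgen P c c 1 1 * wd A hgen P a b 1 n - wd A hgen P a b 1 n * wd A hgen P c c 1 1 = 0 := by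
  have k3 := X.commU c c (X.mem2 a b 1 n)
  simp only [U_C X.heis, if_true, if_false, U_one0, U_one1, U_one2, U_one3, U_one4, map_add,
    map_smul, map_zero, add_zero, zero_add, smul_add, smul_zero, Nat.cast_one, Nat.cast_ofNat,
    Nat.reduceAdd, one_smul, smul_smul, hab, hab.symm, hac, hac.symm, hbc, hbc.symm, C_comm X.heis b a, C_comm X.heis c a,
    C_comm X.heis c b, C_comm X.heis c c 2 1, C_comm X.heis c c 3 1, C_comm X.heis c c 3 2, C_comm X.heis c c 4 1] at k3
  unfold wd
  linear_combination (norm := module) (1 : ℂ) • k3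

theorem Ctx.oz1 (X : Ctx A hgen R P F) {a b : Fin ℓ} (hab : a ≠ b) :
    wd A hgen P a a 1 1 * zz A hgen P b = zz A hgen P b * wd A hgen P a a 1 1 := by
  have k3 := X.commU a a (X.mem2 b b 1 3)
  have k1 := X.commU a a (X.mem2 b b 1 1)
  simp only [U_C X.heis, if_true, if_false, U_one0, U_one1, U_one2, U_one3, U_one4, map_add,
    map_smul, map_zero, add_zero, zero_add, smul_add, smul_zero, Nat.cast_one, Nat.cast_ofNat,
    Nat.reduceAdd, one_smul, smul_smul, hab, hab.symm, C_comm X.heis b a,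
    C_comm X.heis b b 2 1, C_comm X.heis b b 3 1, C_comm X.heis b b 3 2, C_comm X.heis b b 4 1] at k3 k1
  unfold zz wd
  rw [mul_sub, sub_mul]
  linear_combination (norm := module) (1 : ℂ) • k3
    + (-1 : ℂ) • k1

theorem Ctx.oz2 (X : Ctx A hgen R P F) (b : Fin ℓ) :
    wd A hgen P b b 1 1 * zz A hgen P b = zz A hgen P b * wd A hgen P b b 1 1 := by
  have t13 := X.ctr b b 1 3
  have t11 := X.ctr b b 1 1
  simp only [Nat.cast_one, Nat.cast_ofNat, Nat.reduceAdd, C_comm X.heis b b 2 1, C_comm X.heis b b 3 1, C_comm X.heis b b 3 2, C_comm X.heis b b 4 1] at t13 t11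
  have k3 := X.commU b b (X.mem2 b b 1 3)
  have k1 := X.commU b b (X.mem2 b b 1 1)
  simp only [U_C X.heis, if_true, if_false, U_one0, U_one1, U_one2, U_one3, U_one4, map_add,
    map_smul, map_zero, add_zero, zero_add, smul_add, smul_zero, Nat.cast_one, Nat.cast_ofNat,
    Nat.reduceAdd, one_smul, smul_smul, 
    C_comm X.heis b b 2 1, C_comm X.heis b b 3 1, C_comm X.heis b b 3 2, C_comm X.heis b b 4 1] at k3 k1
  unfold zz wd
  rw [mul_sub, sub_mul]
  linear_combination (norm := module) (1 : ℂ) • k3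
    + (-1 : ℂ) • k1
    + (2 : ℂ) • t13 - (2 : ℂ) • t11

theorem Ctx.oo (X : Ctx A hgen R P F) (a b : Fin ℓ) :
    wd A hgen P a a 1 1 * wd A hgen P b b 1 1 = wd A hgen P b b 1 1 * wd A hgen P a a 1 1 := by
  by_cases hab : a = b
  · rw [hab]
  · have k3 := X.commU a a (X.mem2 b b 1 1)
    simp only [U_C X.heis, if_true, if_false, U_one0, U_one1, U_one2, U_one3, U_one4, map_add,
      map_smul, map_zero, add_zero, zero_add, smul_add, smul_zero, Nat.cast_one, Nat.cast_ofNat,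
      Nat.reduceAdd, one_smul, smul_smul, hab, Ne.symm hab, C_comm X.heis b a,
      C_comm X.heis b b 2 1, C_comm X.heis b b 3 1, C_comm X.heis b b 3 2, C_comm X.heis b b 4 1] at k3
    unfold wd
    linear_combination (norm := module) (1 : ℂ) • k3

theorem Ctx.ss (X : Ctx A hgen R P F) {a b c : Fin ℓ} (hab : a ≠ b) (hac : a ≠ c) (hbc : b ≠ c) :
    wd A hgen P a b 1 1 * wd A hgen P b c 1 1 = wd A hgen P b b 1 1 * wd A hgen P a c 1 1
      + wd A hgen P a c 3 1 + (2 : ℂ) • wd A hgen P a c 2 1 + wd A hgen P a c 1 1 := by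
  have k3 := X.mulU a b (X.mem2 b c 1 1)
  have k1 := X.mulU b b (X.mem2 a c 1 1)
  simp only [U_C X.heis, if_true, if_false, U_one0, U_one1, U_one2, U_one3, U_one4, map_add,
    map_smul, map_zero, add_zero, zero_add, smul_add, smul_zero, Nat.cast_one, Nat.cast_ofNat,
    Nat.reduceAdd, one_smul, smul_smul, hab, hab.symm, hac, hac.symm, hbc, hbc.symm, C_comm X.heis c a,
    C_comm X.heis c b, C_comm X.heis c c 2 1, C_comm X.heis c c 3 1, C_comm X.heis c c 3 2, C_comm X.heis c c 4 1] at k3 k1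
  simp only [C_comm X.heis b a, C_comm X.heis c b, C_comm X.heis c a] at k3 k1
  unfold wd
  linear_combination (norm := module) (1 : ℂ) • k3
    + (-1 : ℂ) • k1

theorem Ctx.ssc (X : Ctx A hgen R P F) {a b c : Fin ℓ} (hab : a ≠ b) (hac : a ≠ c) (hbc : b ≠ c) :
    wd A hgen P a b 1 1 * wd A hgen P b c 1 1 - wd A hgen P b c 1 1 * wd A hgen P a b 1 1
      = wd A hgen P a c 2 1 + wd A hgen P a c 1 1 := by
  have k3 := X.commU a b (X.mem2 b c 1 1)
  simp only [U_C X.heis, if_true, if_false, U_one0, U_one1, U_one2, U_one3, U_one4, map_add,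
    map_smul, map_zero, add_zero, zero_add, smul_add, smul_zero, Nat.cast_one, Nat.cast_ofNat,
    Nat.reduceAdd, one_smul, smul_smul, hab, hab.symm, hac, hac.symm, hbc, hbc.symm, C_comm X.heis b a, C_comm X.heis c a,
    C_comm X.heis c b, C_comm X.heis c c 2 1, C_comm X.heis c c 3 1, C_comm X.heis c c 3 2, C_comm X.heis c c 4 1] at k3
  unfold wd
  linear_combination (norm := module) (1 : ℂ) • k3

end
end Zhu

namespace Zhu
open Finset
set_option linter.unusedSimpArgs false
section

/-- The relations in the Zhu algebra from which everything follows. -/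
structure Core {ι R : Type} [Ring R] [Algebra ℂ R] (o z : ι → R) (s eu et la : ι → ι → R) :
    Prop where
  s_symm : ∀ a b, s a b = s b a
  la_symm : ∀ a b, a ≠ b → la a b = la b a
  s_eq : ∀ a b, a ≠ b → s a b = la a b + eu a b + eu b a + (1 / 2 : ℂ) • (et a b + et b a)
  eu_o : ∀ a b, a ≠ b → eu a b * o b - o b * eu a b = (2 : ℂ) • eu a b
  et_o : ∀ a b, a ≠ b → et a b * o b - o b * et a b = et a b
  la_o : ∀ a b, a ≠ b → la a b * o b - o b * la a b = 0
  eu_o' : ∀ a b, a ≠ b → eu a b * o a - o a * eu a b = (-2 : ℂ) • eu a b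
  et_o' : ∀ a b, a ≠ b → et a b * o a - o a * et a b = -et a b
  eu_oc : ∀ a b c, a ≠ b → a ≠ c → b ≠ c → eu a b * o c = o c * eu a b
  et_oc : ∀ a b c, a ≠ b → a ≠ c → b ≠ c → et a b * o c = o c * et a b
  la_oc : ∀ a b c, a ≠ b → a ≠ c → b ≠ c → la a b * o c = o c * la a b
  oo : ∀ a b, o a * o b = o b * o a
  oz : ∀ a b, o a * z b = z b * o a
  sz : ∀ a b, a ≠ b → s a b * z b
    = eu a b + (15 / 256 : ℂ) • et a b - (1 / 256 : ℂ) • et b a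
  zs : ∀ a b, a ≠ b → z b * s a b
    = eu b a + (15 / 256 : ℂ) • et b a - (1 / 256 : ℂ) • et a b
  szc : ∀ a b c, a ≠ b → a ≠ c → b ≠ c → s a b * z c = -((1 / 256 : ℂ) • (et a b + et b a))
  zsc : ∀ a b c, a ≠ b → a ≠ c → b ≠ c → z c * s a b = -((1 / 256 : ℂ) • (et a b + et b a))
  ss : ∀ a b c, a ≠ b → a ≠ c → b ≠ c → s a b * s b c = o b * s a c
    + eu a c + (3 / 16 : ℂ) • et a c - (1 / 16 : ℂ) • et c a
  ssc : ∀ a b c, a ≠ b → a ≠ c → b ≠ c → s a b * s b c - s b c * s a b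
    = eu a c - eu c a + (1 / 4 : ℂ) • (et a c - et c a)
  oc1 : ∀ a b c, a ≠ b → a ≠ c → b ≠ c →
    o c * (eu a b - eu b a + (1 / 4 : ℂ) • (et a b - et b a)) = (1 / 32 : ℂ) • (et a b - et b a)
  sss : ∀ a b, a ≠ b → ∀ x, x = eu a b - eu b a + (1 / 4 : ℂ) • (et a b - et b a) →
    s a b * (s a b * x - x * s a b) - (s a b * x - x * s a b) * s a b
      = (4 : ℂ) • (eu a b - eu b a) + (1 / 4 : ℂ) • (et a b - et b a)

variable {V : Type} [AddCommGroup V] [Module ℂ V] {ℓ : ℕ}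
variable (A : VOA V) (hgen : Fin ℓ → V) {R : Type} [Ring R] [Algebra ℂ R]
    (P : V →ₗ[ℂ] R) {F : Submodule ℂ V}

noncomputable def euR (a b : Fin ℓ) : R :=
  (5 : ℂ) • wd A hgen P a b 1 2 + (25 : ℂ) • wd A hgen P a b 1 3 + (36 : ℂ) • wd A hgen P a b 1 4
    + (16 : ℂ) • wd A hgen P a b 1 5

noncomputable def etR (a b : Fin ℓ) : R :=
  (-16 : ℂ) • ((3 : ℂ) • wd A hgen P a b 1 2 + (14 : ℂ) • wd A hgen P a b 1 3
    + (19 : ℂ) • wd A hgen P a b 1 4 + (8 : ℂ) • wd A hgen P a b 1 5)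

noncomputable def laR (a b : Fin ℓ) : R :=
  (45 : ℂ) • wd A hgen P a b 1 2 + (190 : ℂ) • wd A hgen P a b 1 3
    + (240 : ℂ) • wd A hgen P a b 1 4 + (96 : ℂ) • wd A hgen P a b 1 5

variable {A hgen P}

theorem Ctx.euR_swap (X : Ctx A hgen R P F) (a b : Fin ℓ) : euR A hgen P b a
    = (5 : ℂ) • wd A hgen P a b 2 1 + (25 : ℂ) • wd A hgen P a b 3 1
      + (36 : ℂ) • wd A hgen P a b 4 1 + (16 : ℂ) • wd A hgen P a b 5 1 := by
  simp only [euR, X.sw a b]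

theorem Ctx.etR_swap (X : Ctx A hgen R P F) (a b : Fin ℓ) : etR A hgen P b a
    = (-16 : ℂ) • ((3 : ℂ) • wd A hgen P a b 2 1 + (14 : ℂ) • wd A hgen P a b 3 1
      + (19 : ℂ) • wd A hgen P a b 4 1 + (8 : ℂ) • wd A hgen P a b 5 1) := by
  simp only [etR, X.sw a b]

theorem Ctx.laR_swap (X : Ctx A hgen R P F) (a b : Fin ℓ) : laR A hgen P b a
    = (45 : ℂ) • wd A hgen P a b 2 1 + (190 : ℂ) • wd A hgen P a b 3 1
      + (240 : ℂ) • wd A hgen P a b 4 1 + (96 : ℂ) • wd A hgen P a b 5 1 := by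
  simp only [laR, X.sw a b]

theorem Ctx.sss (X : Ctx A hgen R P F) {a b : Fin ℓ} (hab : a ≠ b) (x : R)
    (hx : x = -wd A hgen P a b 1 1 - wd A hgen P a b 1 2) :
    wd A hgen P a b 1 1 * (wd A hgen P a b 1 1 * x - x * wd A hgen P a b 1 1)
      - (wd A hgen P a b 1 1 * x - x * wd A hgen P a b 1 1) * wd A hgen P a b 1 1
      = (-4 : ℂ) • (wd A hgen P a b 1 1 + (7 : ℂ) • wd A hgen P a b 1 2
        + (12 : ℂ) • wd A hgen P a b 1 3 + (6 : ℂ) • wd A hgen P a b 1 4) := by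
  have k := X.commU a b (X.mem2 a b 1 2)
  have k1 := X.commU a b (X.mem2 b b 2 2)
  have k2 := X.commU a b (X.mem2 b b 1 2)
  have k3 := X.commU a b (X.mem2 a a 1 3)
  have k4 := X.commU a b (X.mem2 a a 1 2)
  simp only [U_C X.heis, if_true, if_false, U_one0, U_one1, map_add,
    map_smul, map_zero, add_zero, zero_add, smul_add, smul_zero, Nat.cast_one, Nat.cast_ofNat,
    Nat.reduceAdd, one_smul, smul_smul, hab, hab.symm, C_comm X.heis b a] at k k1 k2 k3 k4
  simp only [wd_def] at k k1 k2 k3 k4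
  have e : wd A hgen P a b 1 1 * x - x * wd A hgen P a b 1 1
      = -(wd A hgen P b b 2 2 + wd A hgen P b b 1 2 + (2 : ℂ) • wd A hgen P a a 1 3
        + (2 : ℂ) • wd A hgen P a a 1 2) := by
    rw [hx]
    simp only [mul_sub, sub_mul, mul_neg, neg_mul]
    linear_combination (norm := module) (-1 : ℂ) • k
  rw [e]
  simp only [mul_neg, neg_mul, mul_add, add_mul, mul_smul_comm, smul_mul_assoc]
  simp only [X.w21, X.w22, X.w23, X.w31, X.w32, X.w41] at k1 k2 k3 k4 ⊢
  linear_combination (norm := module) (-1 : ℂ) • k1 - k2 - (2 : ℂ) • k3 - (2 : ℂ) • k4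

theorem Ctx.s1_eq (X : Ctx A hgen R P F) (a b : Fin ℓ) :
    euR A hgen P a b - euR A hgen P b a
      + (1 / 4 : ℂ) • (etR A hgen P a b - etR A hgen P b a)
      = -wd A hgen P a b 1 1 - wd A hgen P a b 1 2 := by
  rw [X.euR_swap a b, X.etR_swap a b]
  unfold euR etR
  simp only [X.w21, X.w31, X.w41, X.w51]
  module

theorem Ctx.core (X : Ctx A hgen R P F) : Core (fun a => wd A hgen P a a 1 1) (zz A hgen P)
    (fun a b => wd A hgen P a b 1 1) (euR A hgen P) (etR A hgen P) (laR A hgen P) where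
  s_symm a b := X.sw b a 1 1
  la_symm a b _ := by
    rw [X.laR_swap a b]
    unfold laR
    simp only [X.w21, X.w31, X.w41, X.w51]
    module
  s_eq a b _ := by
    rw [X.euR_swap a b, X.etR_swap a b]
    unfold euR etR laR
    simp only [X.w21, X.w31, X.w41, X.w51]
    module
  eu_o a b hab := by
    have h2 := X.ob hab 2
    have h3 := X.ob hab 3
    have h4 := X.ob hab 4
    have h5 := X.ob hab 5
    norm_num at h2 h3 h4 h5
    have hM := X.M1 hab
    unfold euR
    simp only [mul_add, add_mul, mul_smul_comm, smul_mul_assoc]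
    linear_combination (norm := module) (-5 : ℂ) • h2 - (25 : ℂ) • h3 - (36 : ℂ) • h4
      - (16 : ℂ) • h5 + (4 / 3 : ℂ) • hM
  et_o a b hab := by
    have h2 := X.ob hab 2
    have h3 := X.ob hab 3
    have h4 := X.ob hab 4
    have h5 := X.ob hab 5
    norm_num at h2 h3 h4 h5
    have hM := X.M1 hab
    unfold etR
    simp only [mul_add, add_mul, mul_smul_comm, smul_mul_assoc]
    linear_combination (norm := module) (16 * 3 : ℂ) • h2 + (16 * 14 : ℂ) • h3
      + (16 * 19 : ℂ) • h4 + (16 * 8 : ℂ) • h5 - (32 / 3 : ℂ) • hM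
  la_o a b hab := by
    have h2 := X.ob hab 2
    have h3 := X.ob hab 3
    have h4 := X.ob hab 4
    have h5 := X.ob hab 5
    norm_num at h2 h3 h4 h5
    have hM := X.M1 hab
    unfold laR
    simp only [mul_add, add_mul, mul_smul_comm, smul_mul_assoc]
    linear_combination (norm := module) (-45 : ℂ) • h2 - (190 : ℂ) • h3 - (240 : ℂ) • h4
      - (96 : ℂ) • h5 + (8 : ℂ) • hM
  eu_o' a b hab := by
    have h2 := X.oa hab 2
    have h3 := X.oa hab 3
    have h4 := X.oa hab 4
    have h5 := X.oa hab 5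
    norm_num at h2 h3 h4 h5
    have hM := X.M1 hab
    unfold euR
    simp only [mul_add, add_mul, mul_smul_comm, smul_mul_assoc]
    linear_combination (norm := module) (-5 : ℂ) • h2 - (25 : ℂ) • h3 - (36 : ℂ) • h4
      - (16 : ℂ) • h5 - (4 / 3 : ℂ) • hM
  et_o' a b hab := by
    have h2 := X.oa hab 2
    have h3 := X.oa hab 3
    have h4 := X.oa hab 4
    have h5 := X.oa hab 5
    norm_num at h2 h3 h4 h5
    have hM := X.M1 hab
    unfold etR
    simp only [mul_add, add_mul, mul_smul_comm, smul_mul_assoc]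
    linear_combination (norm := module) (16 * 3 : ℂ) • h2 + (16 * 14 : ℂ) • h3
      + (16 * 19 : ℂ) • h4 + (16 * 8 : ℂ) • h5 + (32 / 3 : ℂ) • hM
  eu_oc a b c hab hac hbc := by
    have h := fun n => X.oc hab hac hbc n
    simp only [sub_eq_zero] at h
    unfold euR
    simp only [mul_add, add_mul, mul_smul_comm, smul_mul_assoc, h]
  et_oc a b c hab hac hbc := by
    have h := fun n => X.oc hab hac hbc n
    simp only [sub_eq_zero] at h
    unfold etR
    simp only [mul_add, add_mul, mul_smul_comm, smul_mul_assoc, h]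
  la_oc a b c hab hac hbc := by
    have h := fun n => X.oc hab hac hbc n
    simp only [sub_eq_zero] at h
    unfold laR
    simp only [mul_add, add_mul, mul_smul_comm, smul_mul_assoc, h]
  oo a b := X.oo a b
  oz a b := by
    by_cases hab : a = b
    · subst hab; exact X.oz2 a
    · exact X.oz1 hab
  sz a b hab := by
    rw [X.Z2 hab, X.etR_swap a b]
    unfold euR etR
    simp only [X.w21, X.w31, X.w41, X.w51]
    module
  zs a b hab := by
    have h1 := X.Z2 hab
    have h2 := X.Z2c hab
    simp only [X.w21, X.w23, X.w31, X.w41, X.w51] at h2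
    rw [X.etR_swap a b, X.euR_swap a b]
    unfold etR
    simp only [X.w21, X.w31, X.w41, X.w51]
    linear_combination (norm := module) h1 - h2
  szc a b c hab hac hbc := by
    rw [X.Z1 hab hac hbc, X.etR_swap a b]
    unfold etR
    simp only [X.w21, X.w31, X.w41, X.w51]
    module
  zsc a b c hab hac hbc := by
    rw [← X.Z1c hab hac hbc, X.Z1 hab hac hbc, X.etR_swap a b]
    unfold etR
    simp only [X.w21, X.w31, X.w41, X.w51]
    module
  ss a b c hab hac hbc := by
    rw [X.ss hab hac hbc, X.etR_swap a c]
    unfold euR etR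
    simp only [X.w21, X.w31, X.w41, X.w51]
    module
  ssc a b c hab hac hbc := by
    rw [X.ssc hab hac hbc, X.s1_eq]
    simp only [X.w21]
    module
  oc1 a b c hab hac hbc := by
    rw [X.s1_eq, X.W hab hac hbc, X.etR_swap a b]
    unfold etR
    simp only [X.w21, X.w31, X.w41, X.w51]
    module
  sss a b hab x hx := by
    rw [X.s1_eq] at hx
    rw [X.sss hab x hx, X.etR_swap a b, X.euR_swap a b]
    unfold euR etR
    simp only [X.w21, X.w31, X.w41, X.w51]
    module
end
end Zhu

namespace Zhu
set_option linter.unusedSimpArgs false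
section

variable {R : Type} [Ring R] [Algebra ℂ R]

theorem sep5 (T : R →ₗ[ℂ] R) {x0 x1 x2 x3 x4 : R} (h : x0 + x1 + x2 + x3 + x4 = 0)
    (e0 : T x0 = 0) (e1 : T x1 = (2 : ℂ) • x1) (e2 : T x2 = (-2 : ℂ) • x2) (e3 : T x3 = x3)
    (e4 : T x4 = -x4) : x0 = 0 ∧ x1 = 0 ∧ x2 = 0 ∧ x3 = 0 ∧ x4 = 0 := by
  have h1 := congrArg T h
  simp only [map_add, map_smul, map_zero, map_neg, e0, e1, e2, e3, e4] at h1
  have h2 := congrArg T h1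
  simp only [map_add, map_smul, map_zero, map_neg, e0, e1, e2, e3, e4] at h2
  have h3 := congrArg T h2
  simp only [map_add, map_smul, map_zero, map_neg, e0, e1, e2, e3, e4] at h3
  have h4 := congrArg T h3
  simp only [map_add, map_smul, map_zero, map_neg, e0, e1, e2, e3, e4] at h4
  refine ⟨?_, ?_, ?_, ?_, ?_⟩
  · linear_combination (norm := module) (1 / 4 : ℂ) • (h4 - (5 : ℂ) • h2 + (4 : ℂ) • h)
  · linear_combination (norm := module) (1 / 24 : ℂ) • (h4 + (2 : ℂ) • h3 - h2 - (2 : ℂ) • h1)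
  · linear_combination (norm := module) (1 / 24 : ℂ) • (h4 - (2 : ℂ) • h3 - h2 + (2 : ℂ) • h1)
  · linear_combination (norm := module)
      (-1 / 6 : ℂ) • (h4 + h3 - (4 : ℂ) • h2 - (4 : ℂ) • h1)
  · linear_combination (norm := module)
      (-1 / 6 : ℂ) • (h4 - h3 - (4 : ℂ) • h2 + (4 : ℂ) • h1)

/-- Separation for left multiplication by `z`. -/
theorem sep4 (z : R) {x0 x1 x2 x3 : R} (h : x0 + x1 + x2 + x3 = 0)
    (e0 : z * x0 = 0) (e1 : z * x1 = x1) (e2 : z * x2 = (15 / 128 : ℂ) • x2)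
    (e3 : z * x3 = (-1 / 128 : ℂ) • x3) : x1 = 0 ∧ x2 = 0 := by
  have h1 := congrArg (z * ·) h
  simp only [mul_add, mul_smul_comm, mul_zero, e0, e1, e2, e3] at h1
  have h2 := congrArg (z * ·) h1
  simp only [mul_add, mul_smul_comm, mul_zero, e0, e1, e2, e3] at h2
  have h3 := congrArg (z * ·) h2
  simp only [mul_add, mul_smul_comm, mul_zero, e0, e1, e2, e3] at h3
  constructor
  · linear_combination (norm := module) (128 * 128 / (113 * 129) : ℂ) • (h3 - (14 / 128 : ℂ) • h2
      - (15 / (128 * 128) : ℂ) • h1)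
  · linear_combination (norm := module) (-128 * 128 * 128 / (15 * 113 * 16) : ℂ) • (h3
      - (127 / 128 : ℂ) • h2 - (1 / 128 : ℂ) • h1)

/-- `x ↦ x o - o x`. -/
noncomputable def del (o : R) : R →ₗ[ℂ] R := LinearMap.mulRight ℂ o - LinearMap.mulLeft ℂ o

theorem del_apply (o x : R) : del o x = x * o - o * x := by simp [del]

theorem del_mul_right {o w : R} (hw : o * w = w * o) (x : R) : del o (x * w) = del o x * w := by
  simp only [del_apply, sub_mul, mul_assoc, hw]

theorem del_mul_left {o w : R} (hw : o * w = w * o) (x : R) : del o (w * x) = w * del o x := by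
  simp only [del_apply, mul_sub, ← mul_assoc, hw]

variable {ι : Type} {o z : ι → R} {s eu et la : ι → ι → R}

/-- Separation of the five components of an element of index pair `a b`. -/
theorem Core.right (K : Core o z s eu et la) {a b : ι} (hab : a ≠ b) {w : R} (hw : o b * w = w * o b)
    {α β γ δ : ℂ}
    (h : s a b * w = α • eu a b + β • eu b a + (1 / 2 * γ) • et a b + (1 / 2 * δ) • et b a) :
    la a b * w = 0 ∧ eu a b * w = α • eu a b ∧ eu b a * w = β • eu b a
      ∧ et a b * w = γ • et a b ∧ et b a * w = δ • et b a := by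
  have e1 : del (o b) (eu a b) = (2 : ℂ) • eu a b := by rw [del_apply, K.eu_o a b hab]
  have e2 : del (o b) (eu b a) = (-2 : ℂ) • eu b a := by rw [del_apply, K.eu_o' b a hab.symm]
  have e3 : del (o b) (et a b) = et a b := by rw [del_apply, K.et_o a b hab]
  have e4 : del (o b) (et b a) = -et b a := by rw [del_apply, K.et_o' b a hab.symm]
  have e0 : del (o b) (la a b) = 0 := by rw [del_apply, K.la_o a b hab]
  rw [K.s_eq a b hab] at h
  simp only [add_mul, smul_mul_assoc] at h
  obtain ⟨h0, h1, h2, h3, h4⟩ := sep5 (del (o b)) (x0 := la a b * w)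
    (x1 := eu a b * w - α • eu a b) (x2 := eu b a * w - β • eu b a)
    (x3 := (1 / 2 : ℂ) • (et a b * w - γ • et a b)) (x4 := (1 / 2 : ℂ) • (et b a * w - δ • et b a))
    (by linear_combination (norm := module) h)
    (by rw [del_mul_right hw, e0, zero_mul])
    (by rw [map_sub, map_smul, del_mul_right hw, e1, smul_mul_assoc]; module)
    (by rw [map_sub, map_smul, del_mul_right hw, e2, smul_mul_assoc]; module)
    (by rw [map_smul, map_sub, map_smul, del_mul_right hw, e3])
    (by rw [map_smul, map_sub, map_smul, del_mul_right hw, e4, neg_mul]; module)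
  refine ⟨h0, sub_eq_zero.1 h1, sub_eq_zero.1 h2, ?_, ?_⟩
  · linear_combination (norm := module) (2 : ℂ) • h3
  · linear_combination (norm := module) (2 : ℂ) • h4

theorem Core.left (K : Core o z s eu et la) {a b : ι} (hab : a ≠ b) {w : R} (hw : o b * w = w * o b)
    {α β γ δ : ℂ}
    (h : w * s a b = α • eu a b + β • eu b a + (1 / 2 * γ) • et a b + (1 / 2 * δ) • et b a) :
    w * la a b = 0 ∧ w * eu a b = α • eu a b ∧ w * eu b a = β • eu b a
      ∧ w * et a b = γ • et a b ∧ w * et b a = δ • et b a := by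
  have e1 : del (o b) (eu a b) = (2 : ℂ) • eu a b := by rw [del_apply, K.eu_o a b hab]
  have e2 : del (o b) (eu b a) = (-2 : ℂ) • eu b a := by rw [del_apply, K.eu_o' b a hab.symm]
  have e3 : del (o b) (et a b) = et a b := by rw [del_apply, K.et_o a b hab]
  have e4 : del (o b) (et b a) = -et b a := by rw [del_apply, K.et_o' b a hab.symm]
  have e0 : del (o b) (la a b) = 0 := by rw [del_apply, K.la_o a b hab]
  rw [K.s_eq a b hab] at h
  simp only [mul_add, mul_smul_comm] at h
  obtain ⟨h0, h1, h2, h3, h4⟩ := sep5 (del (o b)) (x0 := w * la a b)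
    (x1 := w * eu a b - α • eu a b) (x2 := w * eu b a - β • eu b a)
    (x3 := (1 / 2 : ℂ) • (w * et a b - γ • et a b)) (x4 := (1 / 2 : ℂ) • (w * et b a - δ • et b a))
    (by linear_combination (norm := module) h)
    (by rw [del_mul_left hw, e0, mul_zero])
    (by rw [map_sub, map_smul, del_mul_left hw, e1, mul_smul_comm]; module)
    (by rw [map_sub, map_smul, del_mul_left hw, e2, mul_smul_comm]; module)
    (by rw [map_smul, map_sub, map_smul, del_mul_left hw, e3])
    (by rw [map_smul, map_sub, map_smul, del_mul_left hw, e4, mul_neg]; module)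
  refine ⟨h0, sub_eq_zero.1 h1, sub_eq_zero.1 h2, ?_, ?_⟩
  · linear_combination (norm := module) (2 : ℂ) • h3
  · linear_combination (norm := module) (2 : ℂ) • h4

theorem Core.right_b (K : Core o z s eu et la) {a b : ι} (hab : a ≠ b) :
    la a b * z b = 0 ∧ eu a b * z b = (1 : ℂ) • eu a b ∧ eu b a * z b = (0 : ℂ) • eu b a
      ∧ et a b * z b = (15 / 128 : ℂ) • et a b ∧ et b a * z b = (-1 / 128 : ℂ) • et b a :=
  K.right hab (w := z b) (K.oz b b) (α := 1) (β := 0) (γ := 15 / 128) (δ := -1 / 128)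
    (by rw [K.sz a b hab]; module)

theorem Core.left_b (K : Core o z s eu et la) {a b : ι} (hab : a ≠ b) :
    z b * la a b = 0 ∧ z b * eu a b = (0 : ℂ) • eu a b ∧ z b * eu b a = (1 : ℂ) • eu b a
      ∧ z b * et a b = (-1 / 128 : ℂ) • et a b ∧ z b * et b a = (15 / 128 : ℂ) • et b a :=
  K.left hab (w := z b) (K.oz b b) (α := 0) (β := 1) (γ := -1 / 128) (δ := 15 / 128)
    (by rw [K.zs a b hab]; module)

theorem Core.right_c (K : Core o z s eu et la) {a b c : ι} (hab : a ≠ b) (hac : a ≠ c) (hbc : b ≠ c) :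
    la a b * z c = 0 ∧ eu a b * z c = (0 : ℂ) • eu a b ∧ eu b a * z c = (0 : ℂ) • eu b a
      ∧ et a b * z c = (-1 / 128 : ℂ) • et a b ∧ et b a * z c = (-1 / 128 : ℂ) • et b a :=
  K.right hab (w := z c) (K.oz b c) (α := 0) (β := 0) (γ := -1 / 128) (δ := -1 / 128)
    (by rw [K.szc a b c hab hac hbc]; module)

theorem Core.left_c (K : Core o z s eu et la) {a b c : ι} (hab : a ≠ b) (hac : a ≠ c) (hbc : b ≠ c) :
    z c * la a b = 0 ∧ z c * eu a b = (0 : ℂ) • eu a b ∧ z c * eu b a = (0 : ℂ) • eu b a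
      ∧ z c * et a b = (-1 / 128 : ℂ) • et a b ∧ z c * et b a = (-1 / 128 : ℂ) • et b a :=
  K.left hab (w := z c) (K.oz b c) (α := 0) (β := 0) (γ := -1 / 128) (δ := -1 / 128)
    (by rw [K.zsc a b c hab hac hbc]; module)

theorem Core.eu_z (K : Core o z s eu et la) {a b : ι} (hab : a ≠ b) : eu a b * z b = eu a b := by
  simpa using (K.right_b hab).2.1

theorem Core.z_eu (K : Core o z s eu et la) {a b : ι} (hab : a ≠ b) : z a * eu a b = eu a b := by
  simpa using (K.left_b hab.symm).2.2.1

theorem Core.et_z (K : Core o z s eu et la) {a b : ι} (hab : a ≠ b) :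
    et a b * z b = (15 / 128 : ℂ) • et a b := (K.right_b hab).2.2.2.1

theorem Core.z_et (K : Core o z s eu et la) {a b : ι} (hab : a ≠ b) :
    z a * et a b = (15 / 128 : ℂ) • et a b := (K.left_b hab.symm).2.2.2.2

theorem Core.eu_z_ne (K : Core o z s eu et la) {a b c : ι} (hab : a ≠ b) (h : b ≠ c) :
    eu a b * z c = 0 := by
  by_cases hac : a = c
  · subst hac; simpa using (K.right_b hab.symm).2.2.1
  · simpa using (K.right_c hab hac h).2.1

theorem Core.z_eu_ne (K : Core o z s eu et la) {a b c : ι} (hab : a ≠ b) (h : c ≠ a) :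
    z c * eu a b = 0 := by
  by_cases hbc : b = c
  · subst hbc; simpa using (K.left_b hab).2.1
  · simpa using (K.left_c hab h.symm hbc).2.1

theorem Core.et_z_ne (K : Core o z s eu et la) {a b c : ι} (hab : a ≠ b) (h : b ≠ c) :
    et a b * z c = (-1 / 128 : ℂ) • et a b := by
  by_cases hac : a = c
  · subst hac; exact (K.right_b hab.symm).2.2.2.2
  · exact (K.right_c hab hac h).2.2.2.1

theorem Core.z_et_ne (K : Core o z s eu et la) {a b c : ι} (hab : a ≠ b) (h : c ≠ a) :
    z c * et a b = (-1 / 128 : ℂ) • et a b := by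
  by_cases hbc : b = c
  · subst hbc; exact (K.left_b hab).2.2.2.1
  · exact (K.left_c hab h.symm hbc).2.2.2.1

theorem Core.la_z (K : Core o z s eu et la) {a b : ι} (hab : a ≠ b) (c : ι) : la a b * z c = 0 := by
  by_cases hbc : b = c
  · subst hbc; exact (K.right_b hab).1
  by_cases hac : a = c
  · subst hac; rw [K.la_symm a b hab]; exact (K.right_b hab.symm).1
  · exact (K.right_c hab hac hbc).1

theorem Core.z_la (K : Core o z s eu et la) {a b : ι} (hab : a ≠ b) (c : ι) : z c * la a b = 0 := by
  by_cases hbc : b = c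
  · subst hbc; exact (K.left_b hab).1
  by_cases hac : a = c
  · subst hac; rw [K.la_symm a b hab]; exact (K.left_b hab.symm).1
  · exact (K.left_c hab hac hbc).1

theorem kill {x w y : R} {α β : ℂ} (h1 : x * w = α • x) (h2 : w * y = β • y) (h : α ≠ β) :
    x * y = 0 := by
  have e : α • (x * y) = β • (x * y) := by
    rw [← smul_mul_assoc, ← h1, mul_assoc, h2, mul_smul_comm]
  have : (α - β) • (x * y) = 0 := by rw [sub_smul, e, sub_self]
  exact (smul_eq_zero.1 this).resolve_left (sub_ne_zero.2 h)

theorem kill' {x w y : R} {β : ℂ} (h1 : x * w = 0) (h2 : w * y = β • y) (h : β ≠ 0) :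
    x * y = 0 := kill (α := 0) (by rw [h1, zero_smul]) h2 h.symm

theorem Core.uu (K : Core o z s eu et la) {a b c d : ι} (hab : a ≠ b) (hcd : c ≠ d)
    (h : b ≠ c) : eu a b * eu c d = 0 := by
  rw [← K.eu_z hab, mul_assoc, K.z_eu_ne hcd h, mul_zero]

theorem Core.tt (K : Core o z s eu et la) {a b c d : ι} (hab : a ≠ b) (hcd : c ≠ d)
    (h : b ≠ c) : et a b * et c d = 0 :=
  kill (K.et_z hab) (K.z_et_ne hcd h) (by norm_num)

theorem Core.ut (K : Core o z s eu et la) {a b c d : ι} (hab : a ≠ b) (hcd : c ≠ d)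
    : eu a b * et c d = 0 := by
  by_cases h : b = c
  · subst h
    exact kill (α := 1) (by rw [K.eu_z hab, one_smul]) (K.z_et hcd) (by norm_num)
  · exact kill (α := 1) (by rw [K.eu_z hab, one_smul]) (K.z_et_ne hcd h) (by norm_num)

theorem Core.tu (K : Core o z s eu et la) {a b c d : ι} (hab : a ≠ b) (hcd : c ≠ d)
    : et a b * eu c d = 0 := by
  by_cases h : b = c
  · subst h
    exact kill (β := 1) (K.et_z hab) (by rw [K.z_eu hcd, one_smul]) (by norm_num)
  · exact kill (β := 1) (K.et_z_ne hab h) (by rw [K.z_eu hcd, one_smul]) (by norm_num)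

theorem Core.lu (K : Core o z s eu et la) {a b c d : ι} (hab : a ≠ b) (hcd : c ≠ d)
    : la a b * eu c d = 0 := by
  rw [← K.z_eu hcd, ← mul_assoc, K.la_z hab, zero_mul]

theorem Core.ul (K : Core o z s eu et la) {a b c d : ι} (hab : a ≠ b) (hcd : c ≠ d)
    : eu a b * la c d = 0 := by
  rw [← K.eu_z hab, mul_assoc, K.z_la hcd, mul_zero]

theorem Core.lt (K : Core o z s eu et la) {a b c d : ι} (hab : a ≠ b) (hcd : c ≠ d)
    : la a b * et c d = 0 := kill' (K.la_z hab c) (K.z_et hcd) (by norm_num)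

theorem Core.tl (K : Core o z s eu et la) {a b c d : ι} (hab : a ≠ b) (hcd : c ≠ d)
    : et a b * la c d = 0 :=
  kill (β := 0) (K.et_z hab) (by rw [K.z_la hcd, zero_smul]) (by norm_num)
theorem Core.s_mul (K : Core o z s eu et la) {a b c : ι} (hab : a ≠ b) (hac : a ≠ c) (hbc : b ≠ c) :
    s a b * s b c = la a b * la b c + eu a b * eu b c + (1 / 4 : ℂ) • (et a b * et b c) := by
  rw [K.s_eq a b hab, K.s_eq b c hbc]
  simp only [mul_add, add_mul, mul_smul_comm, smul_mul_assoc, smul_add]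
  rw [K.lu hab hbc, K.lu hab hbc.symm, K.lt hab hbc, K.lt hab hbc.symm,
    K.ul hab hbc, K.ul hab.symm hbc, K.tl hab hbc, K.tl hab.symm hbc,
    K.ut hab hbc, K.ut hab hbc.symm, K.ut hab.symm hbc, K.ut hab.symm hbc.symm,
    K.tu hab hbc, K.tu hab hbc.symm, K.tu hab.symm hbc, K.tu hab.symm hbc.symm,
    K.uu hab hbc.symm hbc, K.uu hab.symm hbc hab, K.uu hab.symm hbc.symm hac,
    K.tt hab hbc.symm hbc, K.tt hab.symm hbc hab, K.tt hab.symm hbc.symm hac]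
  module

theorem Core.tri (K : Core o z s eu et la) {a b c : ι} (hab : a ≠ b) (hac : a ≠ c) (hbc : b ≠ c) :
    eu a b * eu b c = eu a c ∧ et a b * et b c = et a c := by
  have h1 := K.s_mul hab hac hbc
  have h2 := K.s_mul hbc.symm hac.symm hab.symm
  rw [K.s_symm c b, K.s_symm b a] at h2
  have h3 := K.ssc a b c hab hac hbc
  obtain ⟨e1, e2⟩ := sep4 (z a)
    (x0 := la a b * la b c - la c b * la b a - (eu c b * eu b a - eu c a))
    (x1 := eu a b * eu b c - eu a c) (x2 := (1 / 4 : ℂ) • (et a b * et b c - et a c))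
    (x3 := (1 / 4 : ℂ) • (et c a - et c b * et b a))
    (by linear_combination (norm := module) h3 - h1 + h2)
    (by
      simp only [mul_sub, ← mul_assoc]
      rw [K.z_la hab, K.z_la hbc.symm, K.z_eu_ne hbc.symm hac, K.z_eu_ne hac.symm hac]
      simp)
    (by
      simp only [mul_sub, ← mul_assoc]
      rw [K.z_eu hab, K.z_eu hac])
    (by
      simp only [mul_sub, mul_smul_comm, ← mul_assoc]
      rw [K.z_et hab, K.z_et hac, smul_mul_assoc]
      module)
    (by
      simp only [mul_sub, mul_smul_comm, ← mul_assoc]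
      rw [K.z_et_ne hac.symm hac, K.z_et_ne hbc.symm hac, smul_mul_assoc]
      module)
  refine ⟨sub_eq_zero.1 e1, ?_⟩
  linear_combination (norm := module) (4 : ℂ) • e2

theorem sss_ring {L E F H N x t : R} (ht : t = L + E + F + (1 / 2 : ℂ) • (H + N))
    (hx : x = E - F + (1 / 4 : ℂ) • (H - N))
    (LE : L * E = 0) (LF : L * F = 0) (LH : L * H = 0) (LN : L * N = 0)
    (EL : E * L = 0) (FL : F * L = 0) (HL : H * L = 0) (NL : N * L = 0)
    (EE : E * E = 0) (FF : F * F = 0) (HH : H * H = 0) (NN : N * N = 0)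
    (EH : E * H = 0) (EN : E * N = 0) (FH : F * H = 0) (FN : F * N = 0)
    (HE : H * E = 0) (HF : H * F = 0) (NE : N * E = 0) (NF : N * F = 0) :
    t * (t * x - x * t) - (t * x - x * t) * t
      = (4 : ℂ) • (E * (F * E) - F * (E * F)) + (1 / 4 : ℂ) • (H * (N * H) - N * (H * N)) := by
  have z2 : ∀ {p q : R}, p * q = 0 → ∀ y, p * (q * y) = 0 := by
    intro p q h y; rw [← mul_assoc, h, zero_mul]
  have e : t * x - x * t = (2 : ℂ) • (F * E - E * F) + (1 / 4 : ℂ) • (N * H - H * N) := by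
    rw [ht, hx]
    simp only [mul_add, add_mul, mul_sub, sub_mul, mul_smul_comm, smul_mul_assoc, LE, LF, LH, LN,
      EL, FL, HL, NL, EE, FF, HH, NN, EH, EN, FH, FN, HE, HF, NE, NF]
    module
  rw [e, ht]
  simp only [mul_add, add_mul, mul_sub, sub_mul, mul_smul_comm, smul_mul_assoc, mul_assoc, LE, LF,
    LH, LN, EL, FL, HL, NL, EE, FF, HH, NN, EH, EN, FH, FN, HE, HF, NE, NF, z2 LE, z2 LF, z2 LH,
    z2 LN, z2 EE, z2 FF, z2 HH, z2 NN, z2 EH, z2 EN, z2 FH, z2 FN, z2 HE, z2 HF, z2 NE, z2 NF,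
    mul_zero]
  module

theorem Core.efe (K : Core o z s eu et la) {a b : ι} (hab : a ≠ b) :
    eu a b * (eu b a * eu a b) = eu a b ∧ et a b * (et b a * et a b) = et a b := by
  have hba := hab.symm
  have h1 := sss_ring (K.s_eq a b hab) rfl (K.lu hab hab) (K.lu hab hba) (K.lt hab hab)
    (K.lt hab hba) (K.ul hab hab) (K.ul hba hab) (K.tl hab hab) (K.tl hba hab)
    (K.uu hab hab hba) (K.uu hba hba hab) (K.tt hab hab hba) (K.tt hba hba hab)
    (K.ut hab hab) (K.ut hab hba) (K.ut hba hab) (K.ut hba hba)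
    (K.tu hab hab) (K.tu hab hba) (K.tu hba hab) (K.tu hba hba)
  have h2 := K.sss a b hab _ rfl
  rw [h1] at h2
  obtain ⟨e1, e2⟩ := sep4 (z a)
    (x0 := (-4 : ℂ) • (eu b a * (eu a b * eu b a) - eu b a))
    (x1 := (4 : ℂ) • (eu a b * (eu b a * eu a b) - eu a b))
    (x2 := (1 / 4 : ℂ) • (et a b * (et b a * et a b) - et a b))
    (x3 := (-1 / 4 : ℂ) • (et b a * (et a b * et b a) - et b a))
    (by linear_combination (norm := module) h2)
    (by
      simp only [mul_sub, mul_smul_comm, ← mul_assoc]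
      rw [K.z_eu_ne hba hab]
      simp)
    (by
      simp only [mul_sub, mul_smul_comm, ← mul_assoc]
      rw [K.z_eu hab])
    (by
      simp only [mul_sub, mul_smul_comm, ← mul_assoc]
      rw [K.z_et hab]
      simp only [smul_mul_assoc]
      module)
    (by
      simp only [mul_sub, mul_smul_comm, ← mul_assoc]
      rw [K.z_et_ne hba hab]
      simp only [smul_mul_assoc]
      module)
  constructor
  · linear_combination (norm := module) (1 / 4 : ℂ) • e1
  · linear_combination (norm := module) (4 : ℂ) • e2

theorem Core.ll (K : Core o z s eu et la) {a b c : ι} (hab : a ≠ b) (hac : a ≠ c) (hbc : b ≠ c) :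
    la a b * la b c = o b * la a c := by
  have h1 := K.s_mul hab hac hbc
  rw [(K.tri hab hac hbc).1, (K.tri hab hac hbc).2] at h1
  have h2 := K.ss a b c hab hac hbc
  have h3 := K.oc1 a c b hac hab hbc.symm
  have hw := K.oo c b
  have e1 : del (o c) (eu a c) = (2 : ℂ) • eu a c := by rw [del_apply, K.eu_o a c hac]
  have e2 : del (o c) (eu c a) = (-2 : ℂ) • eu c a := by rw [del_apply, K.eu_o' c a hac.symm]
  have e3 : del (o c) (et a c) = et a c := by rw [del_apply, K.et_o a c hac]
  have e4 : del (o c) (et c a) = -et c a := by rw [del_apply, K.et_o' c a hac.symm]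
  simp only [mul_add, mul_sub, mul_smul_comm] at h3
  obtain ⟨-, k1, k2, k3, k4⟩ := sep5 (del (o c)) (x0 := 0)
    (x1 := o b * eu a c) (x2 := -(o b * eu c a))
    (x3 := (1 / 4 : ℂ) • (o b * et a c - (1 / 8 : ℂ) • et a c))
    (x4 := (-1 / 4 : ℂ) • (o b * et c a - (1 / 8 : ℂ) • et c a))
    (by linear_combination (norm := module) h3)
    (by simp)
    (by rw [del_mul_left hw, e1, mul_smul_comm])
    (by rw [map_neg, del_mul_left hw, e2, mul_smul_comm]; module)
    (by rw [map_smul, map_sub, map_smul, del_mul_left hw, e3])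
    (by rw [map_smul, map_sub, map_smul, del_mul_left hw, e4, mul_neg]; module)
  rw [K.s_eq a c hac] at h2
  simp only [mul_add, mul_smul_comm] at h2
  linear_combination (norm := module) h2 - h1 + k1 - k2 + (2 : ℂ) • k3 - (2 : ℂ) • k4

end

section
variable {ι R : Type} [DecidableEq ι] [Ring R]

/-- Complete off-diagonal matrix units by diagonal ones. -/
def full (p : ι → ι) (e : ι → ι → R) (a b : ι) : R :=
  if a = b then e a (p a) * e (p a) a else e a b

theorem full_mul {p : ι → ι} (hp : ∀ a, p a ≠ a) {e : ι → ι → R}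
    (m1 : ∀ {a b c d}, a ≠ b → c ≠ d → b ≠ c → e a b * e c d = 0)
    (m2 : ∀ {a b c}, a ≠ b → a ≠ c → b ≠ c → e a b * e b c = e a c)
    (m3 : ∀ {a b}, a ≠ b → e a b * (e b a * e a b) = e a b) (a b c d : ι) :
    full p e a b * full p e c d = if b = c then full p e a d else 0 := by
  have hD : ∀ a b, a ≠ b → e a (p a) * e (p a) a = e a b * e b a := by
    intro a b hab
    by_cases h : b = p a
    · rw [h]
    · rw [← m2 h hab.symm (hp a), ← mul_assoc, m2 hab (hp a).symm h]
  unfold full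
  by_cases hab : a = b
  · subst hab
    rw [if_pos rfl]
    by_cases hac : a = c
    · subst hac
      rw [if_pos rfl]
      by_cases had : a = d
      · subst had
        rw [if_pos rfl, ← mul_assoc, mul_assoc (e a (p a)), m3 (hp a).symm]
      · rw [if_neg had, hD a d had, mul_assoc, m3 had]
    · rw [if_neg hac]
      split_ifs with h
      · rw [← mul_assoc, mul_assoc (e a (p a)), m1 (hp a) (hp c).symm hac, mul_zero, zero_mul]
      · rw [mul_assoc, m1 (hp a) h hac, mul_zero]
  · rw [if_neg hab]
    by_cases hbc : b = c
    · subst hbc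
      rw [if_pos rfl]
      by_cases hbd : b = d
      · subst hbd
        rw [if_pos rfl, if_neg hab, hD b a (Ne.symm hab), m3 hab]
      · rw [if_neg hbd]
        split_ifs with h
        · subst h; rw [hD a b hab]
        · exact m2 hab h hbd
    · rw [if_neg hbc]
      split_ifs with h
      · rw [← mul_assoc, m1 hab (hp c).symm hbc, zero_mul]
      · exact m1 hab h hbc

theorem mul_full {p : ι → ι} (hp : ∀ a, p a ≠ a) {e : ι → ι → R} {x : R}
    (h : ∀ {c d}, c ≠ d → x * e c d = 0) (c d : ι) : x * full p e c d = 0 := by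
  unfold full
  split_ifs with hcd
  · rw [← mul_assoc, h (hp c).symm, zero_mul]
  · exact h hcd

theorem full_mul_left {p : ι → ι} (hp : ∀ a, p a ≠ a) {e : ι → ι → R} {x : R}
    (h : ∀ {c d}, c ≠ d → e c d * x = 0) (c d : ι) : full p e c d * x = 0 := by
  unfold full
  split_ifs with hcd
  · rw [mul_assoc, h (hp c), mul_zero]
  · exact h hcd
end
end Zhu

/-- Proposition 5.3.3. In `A(𝓗⁺)`, for all indices
`a,b,c,d` (where the diagonal elements are `E^*_{aa} = E^*_{a p(a)} * E^*_{p(a) a}`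
for any choice of `p a ≠ a`):
(i) `E^u_{ab} * E^u_{cd} = δ_{bc} E^u_{ad}`;
(ii) `E^t_{ab} * E^t_{cd} = δ_{bc} E^t_{ad}`;
(iii) `E^u_{ab} * E^t_{cd} = 0` and `E^t_{cd} * E^u_{ab} = 0`;
(iv) for `a ≠ b`, `Λ_{ab} * E^*_{cd} = E^*_{cd} * Λ_{ab} = 0`;
(v) for `a,b,c` distinct, `Λ_{ab} * Λ_{bc} = 2 ω_b * Λ_{ac}`. -/
theorem statement16 (ℓ : ℕ) {V W : Type} [AddCommGroup V] [Module ℂ V]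
    [AddCommGroup W] [Module ℂ W] (S : HeisenbergPlusSetting ℓ V W)
    (s : Fin ℓ → Fin ℓ → ℤ → ℤ → W)
    (hs : ∀ a b m n, S.ι (s a b m n) = SV S.A S.hgen a b m n)
    (ow : Fin ℓ → W) (how : ∀ a, S.ι (ow a) = omegaV S.A S.hgen a)
    (p : Fin ℓ → Fin ℓ) (hp : ∀ a, p a ≠ a) :
    let Eu : Fin ℓ → Fin ℓ → W := fun a b =>
      if a = b then S.B.star (EuW s a (p a)) (EuW s (p a) a) else EuW s a b
    let Et : Fin ℓ → Fin ℓ → W := fun a b =>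
      if a = b then S.B.star (EtW s a (p a)) (EtW s (p a) a) else EtW s a b
    (∀ a b c d : Fin ℓ,
      S.B.star (Eu a b) (Eu c d)
        - (if b = c then (1 : ℂ) else 0) • Eu a d ∈ S.B.Osub) ∧
    (∀ a b c d : Fin ℓ,
      S.B.star (Et a b) (Et c d)
        - (if b = c then (1 : ℂ) else 0) • Et a d ∈ S.B.Osub) ∧
    (∀ a b c d : Fin ℓ,
      S.B.star (Eu a b) (Et c d) ∈ S.B.Osub ∧ S.B.star (Et c d) (Eu a b) ∈ S.B.Osub) ∧
    (∀ a b c d : Fin ℓ, a ≠ b →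
      S.B.star (LamW s a b) (Eu c d) ∈ S.B.Osub ∧
      S.B.star (Eu c d) (LamW s a b) ∈ S.B.Osub ∧
      S.B.star (LamW s a b) (Et c d) ∈ S.B.Osub ∧
      S.B.star (Et c d) (LamW s a b) ∈ S.B.Osub) ∧
    (∀ a b c : Fin ℓ, a ≠ b → b ≠ c → a ≠ c →
      S.B.star (LamW s a b) (LamW s b c)
        - (2 : ℂ) • S.B.star (ow b) (LamW s a c) ∈ S.B.Osub) := by
  classical
  intro Eu Et
  obtain ⟨R, iR, iA, Z, P, hP, X⟩ := Zhu.exists_ctx S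
  have K := X.core
  have hmem : ∀ x : W, x ∈ S.B.Osub ↔ Z.π x = 0 := by
    intro x
    rw [← Z.ker_eq, LinearMap.mem_ker]
  have hw : ∀ (a b : Fin ℓ) (m n : ℕ), Z.π (s a b m n) = Zhu.wd S.A S.hgen P a b m n := by
    intro a b m n
    rw [← hP, hs]
    rfl
  have w2 : ∀ a b, Z.π (s a b 1 2) = Zhu.wd S.A S.hgen P a b 1 2 := fun a b => hw a b 1 2
  have w3 : ∀ a b, Z.π (s a b 1 3) = Zhu.wd S.A S.hgen P a b 1 3 := fun a b => hw a b 1 3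
  have w4 : ∀ a b, Z.π (s a b 1 4) = Zhu.wd S.A S.hgen P a b 1 4 := fun a b => hw a b 1 4
  have w5 : ∀ a b, Z.π (s a b 1 5) = Zhu.wd S.A S.hgen P a b 1 5 := fun a b => hw a b 1 5
  have hu : ∀ a b, Z.π (EuW s a b) = Zhu.euR S.A S.hgen P a b := by
    intro a b
    simp only [EuW, Zhu.euR, map_add, map_smul, w2, w3, w4, w5]
  have ht : ∀ a b, Z.π (EtW s a b) = Zhu.etR S.A S.hgen P a b := by
    intro a b
    simp only [EtW, Zhu.etR, map_add, map_smul, w2, w3, w4, w5]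
  have hl : ∀ a b, Z.π (LamW s a b) = Zhu.laR S.A S.hgen P a b := by
    intro a b
    simp only [LamW, Zhu.laR, map_add, map_smul, w2, w3, w4, w5]
  have ho : ∀ a, Z.π (ow a) = (1 / 2 : ℂ) • Zhu.wd S.A S.hgen P a a 1 1 := by
    intro a
    rw [← hP, how, omegaV, map_smul]
    rfl
  have hEu : ∀ a b, Z.π (Eu a b) = Zhu.full p (Zhu.euR S.A S.hgen P) a b := by
    intro a b
    simp only [Eu, Zhu.full]
    split_ifs
    · rw [Z.map_star, hu, hu]
    · rw [hu]
  have hEt : ∀ a b, Z.π (Et a b) = Zhu.full p (Zhu.etR S.A S.hgen P) a b := by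
    intro a b
    simp only [Et, Zhu.full]
    split_ifs
    · rw [Z.map_star, ht, ht]
    · rw [ht]
  refine ⟨?_, ?_, ?_, ?_, ?_⟩
  · intro a b c d
    rw [hmem, map_sub, map_smul, Z.map_star, hEu, hEu, hEu,
      Zhu.full_mul hp (fun h1 h2 h3 => K.uu h1 h2 h3) (fun h1 h2 h3 => (K.tri h1 h2 h3).1)
        (fun h => (K.efe h).1)]
    split_ifs <;> simp
  · intro a b c d
    rw [hmem, map_sub, map_smul, Z.map_star, hEt, hEt, hEt,
      Zhu.full_mul hp (fun h1 h2 h3 => K.tt h1 h2 h3) (fun h1 h2 h3 => (K.tri h1 h2 h3).2)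
        (fun h => (K.efe h).2)]
    split_ifs <;> simp
  · intro a b c d
    rw [hmem, hmem, Z.map_star, Z.map_star, hEu, hEt]
    exact ⟨Zhu.full_mul_left hp (fun h => Zhu.mul_full hp (fun h' => K.ut h h') c d) a b,
      Zhu.full_mul_left hp (fun h => Zhu.mul_full hp (fun h' => K.tu h h') a b) c d⟩
  · intro a b c d hab
    rw [hmem, hmem, hmem, hmem, Z.map_star, Z.map_star, Z.map_star, Z.map_star, hEu, hEt, hl]
    exact ⟨Zhu.mul_full hp (fun h => K.lu hab h) c d,
      Zhu.full_mul_left hp (fun h => K.ul h hab) c d,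
      Zhu.mul_full hp (fun h => K.lt hab h) c d,
      Zhu.full_mul_left hp (fun h => K.tl h hab) c d⟩
  · intro a b c hab hbc hac
    rw [hmem, map_sub, map_smul, Z.map_star, Z.map_star, hl, hl, hl, ho, K.ll hab hac hbc,
      smul_mul_assoc, smul_smul]
    norm_num
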